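/- arXiv:1811.05802 — 2 statements merged into one kernel-verified Lean document; each statement's English description precedes it below -/
import Mathlib

section
/- Let K be a continuous unitary representation of the full symmetric group S̄∞ on a Hilbert space H. For fixed n, define the permutation σ_m^n = (n+1, n+m+1)(n+2, n+m+2)···(n+m, n+2m) (a product of disjoint transpositions). Then the sequence of operators K(σ_m^n) converges in the weak operator topology, as m → ∞, to a self-adjoint operator P_n. -/
open MeasureTheory Filter Topology
open scoped InnerProductSpace

/-- The pointwise stabilizer `S(n,∞)` of the first `n` natural numbers inside the full
symmetric group of `ℕ` (all bijections of `ℕ`). -/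
def stabSet (n : ℕ) : Set (Equiv.Perm ℕ) := {s | ∀ i < n, s i = i}

/-- `σ_m^n`, the product of the disjoint transpositions `(n+j, n+m+j)` for `j = 0,…,m-1`. -/
def sigmaPerm (n m : ℕ) : Equiv.Perm ℕ :=
  ((List.range m).map fun j => Equiv.swap (n + j) (n + m + j)).prod

theorem swap_commute_of_ne {α : Type*} [DecidableEq α] {a b c d : α}
    (hac : a ≠ c) (had : a ≠ d) (hbc : b ≠ c) (hbd : b ≠ d) :
    Commute (Equiv.swap a b) (Equiv.swap c d) := by
  have h := Equiv.swap_apply_apply (Equiv.swap a b) c d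
  rw [Equiv.swap_apply_of_ne_of_ne hac.symm hbc.symm,
    Equiv.swap_apply_of_ne_of_ne had.symm hbd.symm] at h
  exact (eq_mul_inv_iff_mul_eq.mp h).symm

theorem prod_swap_sq_eq_one (n m l : ℕ) (hl : l ≤ m) :
    (((List.range l).map fun j => Equiv.swap (n + j) (n + m + j)).prod) ^ 2 = 1 := by
  induction l with
  | zero => simp
  | succ l ih =>
    have hcomm : Commute ((List.range l).map fun j => Equiv.swap (n + j) (n + m + j)).prod
        (Equiv.swap (n + l) (n + m + l)) := by
      refine Commute.list_prod_left _ _ fun x hx => ?_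
      obtain ⟨j, hj, rfl⟩ := List.mem_map.mp hx
      rw [List.mem_range] at hj
      apply swap_commute_of_ne <;> omega
    rw [List.range_succ, List.map_append, List.prod_append, List.map_singleton,
      List.prod_singleton, hcomm.mul_pow, ih (by omega), one_mul, sq, Equiv.swap_mul_self]

theorem sigmaPerm_inv (n m : ℕ) : (sigmaPerm n m)⁻¹ = sigmaPerm n m := by
  rw [inv_eq_iff_mul_eq_one, ← sq]
  exact prod_swap_sq_eq_one n m m le_rfl

/-- The cycle `a ↦ a + 1 ↦ ⋯ ↦ a + m ↦ a`. -/
def rotatePerm (a m : ℕ) : Equiv.Perm ℕ where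
  toFun x := if a ≤ x ∧ x < a + m then x + 1 else if x = a + m then a else x
  invFun x := if a < x ∧ x ≤ a + m then x - 1 else if x = a then a + m else x
  left_inv x := by grind
  right_inv x := by grind

theorem rotatePerm_apply (a m x : ℕ) :
    rotatePerm a m x = if a ≤ x ∧ x < a + m then x + 1 else if x = a + m then a else x :=
  rfl

theorem sigmaPerm_succ (n m : ℕ) :
    sigmaPerm n (m + 1) = rotatePerm (n + m) m * sigmaPerm n m *
      ((rotatePerm (n + m) m)⁻¹ * Equiv.swap (n + m) (n + (m + 1) + m)) := by
  rw [← mul_assoc, ← MulAut.conj_apply, sigmaPerm, sigmaPerm, List.range_succ, List.map_append,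
    List.prod_append, List.map_singleton, List.prod_singleton, map_list_prod, List.map_map]
  congr 2
  refine List.map_congr_left fun j hj => ?_
  rw [List.mem_range] at hj
  rw [Function.comp_apply, MulAut.conj_apply, ← Equiv.swap_apply_apply]
  congr 1 <;> grind [rotatePerm_apply]

theorem stabSet_mul {k : ℕ} {s t : Equiv.Perm ℕ} (hs : s ∈ stabSet k) (ht : t ∈ stabSet k) :
    s * t ∈ stabSet k := fun i hi => by
  rw [Equiv.Perm.mul_apply, ht i hi, hs i hi]

theorem stabSet_inv {k : ℕ} {s : Equiv.Perm ℕ} (hs : s ∈ stabSet k) : s⁻¹ ∈ stabSet k :=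
  fun i hi => by rw [Equiv.Perm.inv_eq_iff_eq, hs i hi]

theorem stabSet_anti {k l : ℕ} (h : k ≤ l) : stabSet l ⊆ stabSet k :=
  fun _ hs i hi => hs i (hi.trans_le h)

/-- All `σ_m^n` with `m ≥ k` lie in one double coset of `S(k,∞)`. -/
theorem exists_sigmaPerm_eq_mul_mul (n : ℕ) {k m : ℕ} (hm : k ≤ m) :
    ∃ s ∈ stabSet k, ∃ t ∈ stabSet k, sigmaPerm n m = s * sigmaPerm n k * t := by
  induction m, hm using Nat.le_induction with
  | base => exact ⟨1, fun _ _ => rfl, 1, fun _ _ => rfl, by simp⟩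
  | succ m hm ih =>
    obtain ⟨s, hs, t, ht, h⟩ := ih
    have hr : rotatePerm (n + m) m ∈ stabSet k := fun i hi => by grind [rotatePerm_apply]
    have hw : Equiv.swap (n + m) (n + (m + 1) + m) ∈ stabSet k := fun i hi =>
      Equiv.swap_apply_of_ne_of_ne (by omega) (by omega)
    refine ⟨_, stabSet_mul hr hs, _, stabSet_mul ht (stabSet_mul (stabSet_inv hr) hw), ?_⟩
    rw [sigmaPerm_succ, h]
    simp only [mul_assoc]

section Representation

variable {H : Type*} [NormedAddCommGroup H] [InnerProductSpace ℂ H]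

theorem inner_map_eq_inner_map_inv {G : Type*} [Group G] (K : G →* (H →L[ℂ] H))
    (hunit : ∀ g (η : H), ‖K g η‖ = ‖η‖) (g : G) (η ζ : H) :
    ⟪K g η, ζ⟫_ℂ = ⟪η, K g⁻¹ ζ⟫_ℂ := by
  let L : H →ₗᵢ[ℂ] H := ⟨(K g : H →ₗ[ℂ] H), hunit g⟩
  have h : L (K g⁻¹ ζ) = ζ := by
    change (K g * K g⁻¹) ζ = ζ
    rw [← map_mul, mul_inv_cancel, map_one, one_apply_eq_self]
  conv_lhs => rw [← h]
  exact L.inner_map_map _ _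

theorem norm_inner_map_le {G : Type*} [Group G] (K : G →* (H →L[ℂ] H))
    (hunit : ∀ g (η : H), ‖K g η‖ = ‖η‖) (g : G) (η ζ : H) :
    ‖⟪K g η, ζ⟫_ℂ‖ ≤ ‖η‖ * ‖ζ‖ :=
  (norm_inner_le_norm _ _).trans_eq (by rw [hunit])

theorem norm_inner_map_mul_mul_sub_le {G : Type*} [Group G] (K : G →* (H →L[ℂ] H))
    (hunit : ∀ g (η : H), ‖K g η‖ = ‖η‖) (s g t : G) (η ζ : H) :
    ‖⟪K (s * g * t) η, ζ⟫_ℂ - ⟪K g η, ζ⟫_ℂ‖ ≤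
      ‖K t η - η‖ * ‖ζ‖ + ‖η‖ * ‖K s⁻¹ ζ - ζ‖ := by
  have h : ⟪K (s * g * t) η, ζ⟫_ℂ - ⟪K g η, ζ⟫_ℂ =
      ⟪K g (K t η - η), K s⁻¹ ζ⟫_ℂ + ⟪K g η, K s⁻¹ ζ - ζ⟫_ℂ := by
    rw [mul_assoc, map_mul, mul_apply_eq_comp, inner_map_eq_inner_map_inv K hunit s,
      map_mul, mul_apply_eq_comp, map_sub, inner_sub_left, inner_sub_right]
    ring
  rw [h]
  refine (norm_add_le _ _).trans (add_le_add ?_ (norm_inner_map_le K hunit _ _ _))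
  simpa only [hunit] using norm_inner_map_le K hunit g (K t η - η) (K s⁻¹ ζ)

theorem cauchySeq_inner_sigmaPerm (K : Equiv.Perm ℕ →* (H →L[ℂ] H))
    (hunit : ∀ g (η : H), ‖K g η‖ = ‖η‖)
    (hcont : ∀ (η : H) (ε : ℝ), 0 < ε → ∃ k : ℕ, ∀ s ∈ stabSet k, ‖K s η - η‖ < ε)
    (n : ℕ) (η ζ : H) : CauchySeq fun m => ⟪K (sigmaPerm n m) η, ζ⟫_ℂ := by
  rw [Metric.cauchySeq_iff']
  intro ε hε
  set C := ‖η‖ + ‖ζ‖ + 1 with hC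
  have hC0 : 0 < C := by positivity
  obtain ⟨k₁, h₁⟩ := hcont η (ε / C) (by positivity)
  obtain ⟨k₂, h₂⟩ := hcont ζ (ε / C) (by positivity)
  refine ⟨max k₁ k₂, fun m hm => ?_⟩
  obtain ⟨s, hs, t, ht, h⟩ := exists_sigmaPerm_eq_mul_mul n hm
  rw [dist_eq_norm, h]
  refine (norm_inner_map_mul_mul_sub_le K hunit _ _ _ _ _).trans_lt ?_
  have ht' := h₁ t (stabSet_anti (le_max_left _ _) ht)
  have hs' := h₂ s⁻¹ (stabSet_anti (le_max_right _ _) (stabSet_inv hs))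
  calc ‖K t η - η‖ * ‖ζ‖ + ‖η‖ * ‖K s⁻¹ ζ - ζ‖
      ≤ ε / C * ‖ζ‖ + ‖η‖ * (ε / C) := by gcongr
    _ = ε / C * (C - 1) := by rw [hC]; ring
    _ < ε / C * C := by gcongr; linarith
    _ = ε := div_mul_cancel₀ _ hC0.ne'

/-- A pointwise weakly convergent, uniformly bounded sequence of operators has a weak operator
limit. -/
theorem exists_tendsto_inner [CompleteSpace H] (A : ℕ → H →L[ℂ] H) (C : ℝ)
    (hA : ∀ m η ζ, ‖⟪A m η, ζ⟫_ℂ‖ ≤ C * ‖η‖ * ‖ζ‖)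
    (hconv : ∀ η ζ : H, ∃ b : ℂ, Tendsto (fun m => ⟪A m η, ζ⟫_ℂ) atTop (𝓝 b)) :
    ∃ P : H →L[ℂ] H, ∀ η ζ : H, Tendsto (fun m => ⟪A m η, ζ⟫_ℂ) atTop (𝓝 ⟪P η, ζ⟫_ℂ) := by
  choose b hb using hconv
  let B : H →ₗ⋆[ℂ] H →ₗ[ℂ] ℂ := LinearMap.mk₂'ₛₗ (starRingEnd ℂ) (RingHom.id ℂ) b
    (fun x y z => tendsto_nhds_unique (hb _ _) <| by
      simpa only [map_add, inner_add_left] using (hb x z).add (hb y z))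
    (fun c x y => tendsto_nhds_unique (hb _ _) <| by
      simpa only [map_smul, inner_smul_left, smul_eq_mul] using (hb x y).const_mul (starRingEnd ℂ c))
    (fun x y z => tendsto_nhds_unique (hb _ _) <| by
      simpa only [inner_add_right] using (hb x y).add (hb x z))
    (fun c x y => tendsto_nhds_unique (hb _ _) <| by
      simpa only [inner_smul_right, smul_eq_mul, RingHom.id_apply] using (hb x y).const_mul c)
  let B' : H →L⋆[ℂ] H →L[ℂ] ℂ := B.mkContinuous₂ C fun η ζ =>
    le_of_tendsto (hb η ζ).norm (Eventually.of_forall fun m => hA m η ζ)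
  refine ⟨InnerProductSpace.continuousLinearMapOfBilin B', fun η ζ => ?_⟩
  rw [InnerProductSpace.continuousLinearMapOfBilin_apply]
  exact hb η ζ

end Representation

/-- for a continuous unitary representation `K` of the full symmetric group,
the operators `K(σ_m^n)` converge in the weak operator topology to a self-adjoint operator. -/
theorem statement1
    {H : Type*} [NormedAddCommGroup H] [InnerProductSpace ℂ H] [CompleteSpace H]
    (K : Equiv.Perm ℕ →* (H →L[ℂ] H))
    (hunit : ∀ g (η : H), ‖K g η‖ = ‖η‖)
    (hcont : ∀ (η : H) (ε : ℝ), 0 < ε → ∃ k : ℕ, ∀ s ∈ stabSet k, ‖K s η - η‖ < ε)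
    (n : ℕ) :
    ∃ P : H →L[ℂ] H, IsSelfAdjoint P ∧
      ∀ η ζ : H, Tendsto (fun m => ⟪K (sigmaPerm n m) η, ζ⟫_ℂ) atTop (𝓝 ⟪P η, ζ⟫_ℂ) := by
  obtain ⟨P, hP⟩ := exists_tendsto_inner (fun m => K (sigmaPerm n m)) 1
    (fun m η ζ => by simpa only [one_mul] using norm_inner_map_le K hunit (sigmaPerm n m) η ζ)
    (fun η ζ => cauchySeq_tendsto_of_complete (cauchySeq_inner_sigmaPerm K hunit hcont n η ζ))
  refine ⟨P, ContinuousLinearMap.isSelfAdjoint_iff_isSymmetric.mpr fun η ζ => ?_, hP⟩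
  refine tendsto_nhds_unique (hP η ζ) ?_
  have h := (Complex.continuous_conj.tendsto _).comp (hP ζ η)
  simp only [inner_conj_symm] at h
  refine h.congr fun m => ?_
  rw [Function.comp_apply, inner_conj_symm, inner_map_eq_inner_map_inv K hunit, sigmaPerm_inv]
end

section
/- Let the full symmetric group S̄∞ of all bijections of ℕ act measurably on a measure space (X, 𝔐, μ) with countably generated σ-algebra 𝔐, such that μ is quasi-invariant (μ∘g is equivalent to μ for every g). Then there exists a (finite or σ-finite) S̄∞-invariant measure ν on X equivalent to μ. -/
open MeasureTheory

section Permutations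

variable {Ω : Type*}

theorem perm_apply_inv_apply (σ : Equiv.Perm Ω) (p : Ω) : σ (σ⁻¹ p) = p :=
  Equiv.apply_symm_apply σ p

theorem perm_inv_apply_apply (σ : Equiv.Perm Ω) (p : Ω) : σ⁻¹ (σ p) = p :=
  Equiv.symm_apply_apply σ p

/-- A swindle: `τ` supported in `B` is a commutator with any `s` whose forward iterates of `B`
avoid `B`. -/
theorem exists_commutator_eq (s τ : Equiv.Perm Ω) (B : Set Ω) (hτ : ∀ p ∉ B, τ p = p)
    (hs : ∀ i : ℕ, 0 < i → ∀ p ∈ B, (s ^ i) p ∉ B) :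
    ∃ a : Equiv.Perm Ω, a * s * a⁻¹ * s⁻¹ = τ ∧
      ∀ p, (∀ i : ℕ, ∀ q ∈ B, p ≠ (s ^ i) q) → a p = p := by
  classical
  have huniq : ∀ i j : ℕ, ∀ q ∈ B, ∀ r ∈ B, (s ^ i) q = (s ^ j) r → i ≤ j → i = j := by
    intro i j q hq r hr h hij
    obtain ⟨k, rfl⟩ := Nat.exists_eq_add_of_le hij
    rw [pow_add, Equiv.Perm.mul_apply] at h
    have := (s ^ i).injective h
    by_contra hne
    exact hs k (by omega) r hr (this ▸ hq)
  let f : Equiv.Perm Ω → Ω → Ω := fun τ p =>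
    if h : ∃ i : ℕ, ∃ q ∈ B, p = (s ^ i) q then (s ^ h.choose) (τ h.choose_spec.choose) else p
  have f1 : ∀ τ : Equiv.Perm Ω, ∀ i : ℕ, ∀ q ∈ B, f τ ((s ^ i) q) = (s ^ i) (τ q) := by
    intro τ i q hq
    have h : ∃ j : ℕ, ∃ r ∈ B, (s ^ i) q = (s ^ j) r := ⟨i, q, hq, rfl⟩
    have hr := h.choose_spec.choose_spec
    have key : ∀ j : ℕ, ∀ r ∈ B, (s ^ i) q = (s ^ j) r → (s ^ j) (τ r) = (s ^ i) (τ q) := by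
      intro j r hr h
      have hij : i = j := by
        rcases le_total i j with h' | h'
        · exact huniq _ _ _ hq _ hr h h'
        · exact (huniq _ _ _ hr _ hq h.symm h').symm
      subst hij
      rw [(s ^ i).injective h]
    simp only [f]
    rw [dif_pos h]
    exact key _ _ hr.1 hr.2
  have f2 : ∀ τ : Equiv.Perm Ω, ∀ p, (¬ ∃ i : ℕ, ∃ q ∈ B, p = (s ^ i) q) → f τ p = p := by
    intro τ p hp
    simp only [f]
    rw [dif_neg hp]
  have hτB : ∀ p ∈ B, τ p ∈ B := by
    intro p hp
    by_contra h
    have := τ.injective (hτ _ h)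
    exact h (this.symm ▸ hp)
  have hτB' : ∀ p ∈ B, τ⁻¹ p ∈ B := by
    intro p hp
    by_contra h
    have := hτ _ h
    rw [perm_apply_inv_apply] at this
    exact h (this ▸ hp)
  let a : Equiv.Perm Ω :=
    { toFun := f τ
      invFun := f τ⁻¹
      left_inv := by
        intro p
        by_cases h : ∃ i : ℕ, ∃ q ∈ B, p = (s ^ i) q
        · obtain ⟨i, q, hq, rfl⟩ := h
          rw [f1 _ _ _ hq, f1 _ _ _ (hτB q hq), perm_inv_apply_apply]
        · rw [f2 τ p h, f2 _ p h]
      right_inv := by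
        intro p
        by_cases h : ∃ i : ℕ, ∃ q ∈ B, p = (s ^ i) q
        · obtain ⟨i, q, hq, rfl⟩ := h
          rw [f1 _ _ _ hq, f1 _ _ _ (hτB' q hq), perm_apply_inv_apply]
        · rw [f2 _ p h, f2 _ p h] }
  refine ⟨a, ?_, ?_⟩
  · have key : a * s = τ * s * a := by
      ext x
      change f τ (s x) = τ (s (f τ x))
      by_cases h : ∃ i : ℕ, ∃ q ∈ B, x = (s ^ i) q
      · obtain ⟨i, q, hq, rfl⟩ := h
        rw [f1 _ _ _ hq, ← Equiv.Perm.mul_apply, ← pow_succ', f1 _ _ _ hq,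
          ← Equiv.Perm.mul_apply s, ← pow_succ', hτ _ (hs _ (by omega) _ (hτB q hq))]
      · rw [f2 _ _ h]
        by_cases h' : ∃ i : ℕ, ∃ q ∈ B, s x = (s ^ i) q
        · obtain ⟨i, q, hq, hi⟩ := h'
          cases i with
          | zero =>
            rw [hi, f1 _ _ _ hq]
            simp
          | succ i =>
            rw [pow_succ', Equiv.Perm.mul_apply] at hi
            exact absurd ⟨i, q, hq, s.injective hi⟩ h
        · rw [f2 _ _ h', hτ]
          intro hx
          exact h' ⟨0, s x, hx, rfl⟩
    rw [key]
    group
  · intro p hp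
    apply f2
    rintro ⟨i, q, hq, h⟩
    exact hp i q hq h

theorem exists_perm_eqOn [Countable Ω] (K : Set Ω) (f : Ω → Ω) (hf : Set.InjOn f K)
    (hK : Kᶜ.Infinite) (hfK : (f '' K)ᶜ.Infinite) : ∃ σ : Equiv.Perm Ω, Set.EqOn σ f K := by
  classical
  have := hK.to_subtype
  have := hfK.to_subtype
  obtain ⟨e⟩ := nonempty_equiv_of_countable (α := (Kᶜ : Set Ω)) (β := ((f '' K)ᶜ : Set Ω))
  refine ⟨Equiv.subtypeCongr (p := (· ∈ K)) (q := (· ∈ f '' K)) (Equiv.Set.imageOfInjOn f K hf) e,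
    ?_⟩
  intro x hx
  simp [Equiv.subtypeCongr, hx, Equiv.Set.imageOfInjOn, Equiv.sumCompl]

/-- A partial injection inside `M` extends to a permutation supported in `M`. -/
theorem exists_perm_eqOn_of_subset [Countable Ω] (M K : Set Ω) (f : Ω → Ω) (hf : Set.InjOn f K)
    (hKM : K ⊆ M) (hfM : Set.MapsTo f K M)
    (hK : (M \ K).Infinite) (hfK : (M \ f '' K).Infinite) :
    ∃ σ : Equiv.Perm Ω, Set.EqOn σ f K ∧ ∀ p ∉ M, σ p = p := by
  classical
  have h1 : ∀ p ∈ K, M.piecewise f id p = f p := fun p hp => by simp [hKM hp]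
  have h2 : ∀ p ∉ M, M.piecewise f id p = p := fun p hp => by simp [hp]
  obtain ⟨σ, hσ⟩ := exists_perm_eqOn (K ∪ Mᶜ) (M.piecewise f id) (by
      rintro p (hp | hp) q (hq | hq) h
      · rw [h1 p hp, h1 q hq] at h
        exact hf hp hq h
      · rw [h1 p hp, h2 q hq] at h
        exact absurd (h ▸ hfM hp) hq
      · rw [h2 p hp, h1 q hq] at h
        exact absurd (h ▸ hfM hq) hp
      · rwa [h2 p hp, h2 q hq] at h)
    (hK.mono fun p hp => by simp [hp.1, hp.2])
    (hfK.mono fun p hp => by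
      rintro ⟨q, hq | hq, rfl⟩
      · exact hp.2 ⟨q, hq, (h1 q hq).symm⟩
      · rw [h2 q hq] at hp
        exact hq hp.1)
  exact ⟨σ, fun p hp => (hσ (Or.inl hp)).trans (h1 p hp),
    fun p hp => (hσ (Or.inr hp)).trans (h2 p hp)⟩

theorem exists_perm_mem_iff [Countable Ω] (M K L : Set Ω) (hKM : K ⊆ M) (hLM : L ⊆ M)
    (hK : K.Infinite) (hL : L.Infinite) (hMK : (M \ K).Infinite) (hML : (M \ L).Infinite) :
    ∃ σ : Equiv.Perm Ω, (∀ p, σ p ∈ L ↔ p ∈ K) ∧ ∀ p ∉ M, σ p = p := by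
  classical
  have := hK.to_subtype
  have := hL.to_subtype
  obtain ⟨e⟩ := nonempty_equiv_of_countable (α := K) (β := L)
  let f : Ω → Ω := fun p => if h : p ∈ K then e ⟨p, h⟩ else p
  have hf : ∀ p (h : p ∈ K), f p = e ⟨p, h⟩ := fun p h => dif_pos h
  have himg : f '' K = L := by
    ext q
    constructor
    · rintro ⟨p, hp, rfl⟩
      rw [hf p hp]
      exact (e _).2
    · intro hq
      refine ⟨e.symm ⟨q, hq⟩, (e.symm _).2, ?_⟩
      rw [hf _ (e.symm _).2]
      simp
  obtain ⟨σ, h1, h2⟩ := exists_perm_eqOn_of_subset M K f (by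
      intro p hp q hq h
      rw [hf p hp, hf q hq] at h
      simpa using e.injective (Subtype.ext h)) hKM
    (fun p hp => hLM (himg ▸ ⟨p, hp, rfl⟩)) hMK (by rwa [himg])
  refine ⟨σ, fun p => ⟨fun h => ?_, fun h => ?_⟩, h2⟩
  · rw [← himg] at h
    obtain ⟨q, hq, hqp⟩ := h
    rw [← h1 hq] at hqp
    exact σ.injective hqp ▸ hq
  · rw [h1 h, ← himg]
    exact ⟨p, h, rfl⟩

theorem exists_perm_eqOn_finite [Infinite Ω] [Countable Ω] (K : Set Ω) (f : Ω → Ω)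
    (hf : Set.InjOn f K) (hK : K.Finite) : ∃ σ : Equiv.Perm Ω, Set.EqOn σ f K :=
  exists_perm_eqOn K f hf hK.infinite_compl (hK.image f).infinite_compl

end Permutations

/-- A separable length function on a group. -/
structure IsSeparableLength {G : Type*} [Group G] (ℓ : G → ℝ) : Prop where
  inv : ∀ g, ℓ g⁻¹ = ℓ g
  mul : ∀ g h, ℓ (g * h) ≤ ℓ g + ℓ h
  exists_seq : ∀ ε > 0, ∃ u : ℕ → G, ∀ g, ∃ n, ℓ ((u n)⁻¹ * g) < ε

namespace IsSeparableLength

theorem conj_le {G : Type*} [Group G] {ℓ : G → ℝ} (hℓ : IsSeparableLength ℓ) (g h : G) :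
    ℓ h ≤ ℓ (g * h * g⁻¹) + 2 * ℓ g := by
  have h1 := hℓ.mul g⁻¹ (g * h * g⁻¹ * g)
  have h2 := hℓ.mul (g * h * g⁻¹) g
  rw [hℓ.inv] at h1
  have h3 : g⁻¹ * (g * h * g⁻¹ * g) = h := by group
  rw [h3] at h1
  linarith

theorem exists_ne_lt {G ι : Type*} [Group G] [Uncountable ι] {ℓ : G → ℝ}
    (hℓ : IsSeparableLength ℓ) (s : ι → G) {ε : ℝ} (hε : 0 < ε) :
    ∃ x y, x ≠ y ∧ ℓ ((s x)⁻¹ * s y) < 2 * ε := by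
  obtain ⟨u, hu⟩ := hℓ.exists_seq ε hε
  choose n hn using fun x => hu (s x)
  have := not_injective_uncountable_countable n
  simp only [Function.Injective, not_forall] at this
  obtain ⟨x, y, hxy, hne⟩ := this
  refine ⟨x, y, hne, ?_⟩
  have h1 := hℓ.mul ((u (n x))⁻¹ * s x)⁻¹ ((u (n x))⁻¹ * s y)
  rw [hℓ.inv] at h1
  have h2 := hn x
  have h3 := hn y
  rw [← hxy] at h3
  have h4 : ((u (n x))⁻¹ * s x)⁻¹ * ((u (n x))⁻¹ * s y) = (s x)⁻¹ * s y := by group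
  rw [h4] at h1
  linarith

/-- In a countable partition, some piece `A` is such that every permutation supported in `A`
agrees on `A` with a short permutation. -/
theorem exists_full {Ω : Type*} {ℓ : Equiv.Perm Ω → ℝ} (hℓ : IsSeparableLength ℓ) (c : Ω → ℕ)
    {ε : ℝ} (hε : 0 < ε) :
    ∃ n, ∀ σ : Equiv.Perm Ω, (∀ p, c p ≠ n → σ p = p) →
      ∃ w, ℓ w < 2 * ε ∧ ∀ p, c p = n → w p = σ p := by
  obtain ⟨u, hu⟩ := hℓ.exists_seq ε hε
  have key : ∃ n, ∀ σ : Equiv.Perm Ω, (∀ p, c p ≠ n → σ p = p) →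
      ∃ w, ℓ w < ε ∧ ∀ p, c p = n → (w * (u n)⁻¹) p = σ p := by
    by_contra! hcon
    choose σ hσ1 hσ2 using hcon
    have hc : ∀ n p, c (σ n p) = n ↔ c p = n := by
      intro n p
      by_cases h : c p = n
      · simp only [h, iff_true]
        by_contra h'
        have := (σ n).injective (hσ1 n _ h')
        rw [this] at h'
        exact h' h
      · rw [hσ1 n p h]
    have hc' : ∀ n p, c ((σ n)⁻¹ p) = n ↔ c p = n := by
      intro n p
      rw [← hc n ((σ n)⁻¹ p), perm_apply_inv_apply]
    let τ : Equiv.Perm Ω :=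
      { toFun := fun p => σ (c p) p
        invFun := fun p => (σ (c p))⁻¹ p
        left_inv := fun p => by
          simp only [(hc (c p) p).2 rfl, perm_inv_apply_apply]
        right_inv := fun p => by
          simp only [(hc' (c p) p).2 rfl, perm_apply_inv_apply] }
    obtain ⟨n, hn⟩ := hu τ⁻¹
    rw [← hℓ.inv] at hn
    obtain ⟨p, hp, h⟩ := hσ2 n _ hn
    apply h
    subst hp
    simp [τ]
  obtain ⟨n, hn⟩ := key
  refine ⟨n, fun σ hσ => ?_⟩
  obtain ⟨w, hw, hw'⟩ := hn σ hσ
  obtain ⟨v, hv, hv'⟩ := hn 1 (fun _ _ => rfl)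
  refine ⟨w * v⁻¹, ?_, fun p hp => ?_⟩
  · have := hℓ.mul w v⁻¹
    rw [hℓ.inv] at this
    linarith
  · rw [← hw' p hp]
    have h1 := hv' p hp
    simp only [Equiv.Perm.mul_apply, Equiv.Perm.one_apply] at h1 ⊢
    congr 1
    rw [Equiv.Perm.inv_eq_iff_eq, h1]

end IsSeparableLength

theorem finite_setOf_floor_mul_eq {x y : ℝ} (hxy : x ≠ y) :
    {m : ℕ | ⌊(m : ℝ) * x⌋ = ⌊(m : ℝ) * y⌋}.Finite := by
  have hpos : 0 < |x - y| := abs_pos.2 (sub_ne_zero.2 hxy)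
  obtain ⟨N, hN⟩ := exists_nat_gt (1 / |x - y|)
  refine (Set.finite_Iio N).subset fun m hm => ?_
  have h1 := Int.abs_sub_lt_one_of_floor_eq_floor hm
  rw [← mul_sub, abs_mul, Nat.abs_cast, ← lt_div_iff₀ hpos] at h1
  exact_mod_cast h1.trans hN

/-- Shift the fibres `{n} × {m} × ℤ` by `⌊m x⌋`. -/
noncomputable def floorShift (n : ℕ) (x : ℝ) : Equiv.Perm (ℕ × ℕ × ℤ) :=
  Equiv.prodShear (Equiv.refl ℕ) fun j => Equiv.prodShear (Equiv.refl ℕ) fun m =>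
    Equiv.addRight (if j = n then ⌊(m : ℝ) * x⌋ else 0)

theorem floorShift_apply (n : ℕ) (x : ℝ) (p : ℕ × ℕ × ℤ) :
    floorShift n x p = (p.1, p.2.1, p.2.2 + if p.1 = n then ⌊(p.2.1 : ℝ) * x⌋ else 0) := rfl

theorem floorShift_inv_apply (n : ℕ) (x : ℝ) (p : ℕ × ℕ × ℤ) :
    (floorShift n x)⁻¹ p =
      (p.1, p.2.1, p.2.2 - if p.1 = n then ⌊(p.2.1 : ℝ) * x⌋ else 0) := by
  rw [Equiv.Perm.inv_eq_iff_eq, floorShift_apply]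
  simp

namespace IsSeparableLength

theorem exists_small_support {ℓ : Equiv.Perm (ℕ × ℕ × ℤ) → ℝ} (hℓ : IsSeparableLength ℓ)
    {ε : ℝ} (hε : 0 < ε) :
    ∃ B : Set (ℕ × ℕ × ℤ), B.Infinite ∧ Bᶜ.Infinite ∧
      ∀ τ : Equiv.Perm (ℕ × ℕ × ℤ), (∀ p ∉ B, τ p = p) → ℓ τ < 8 * ε := by
  obtain ⟨n, hn⟩ := hℓ.exists_full Prod.fst hε
  obtain ⟨x, y, hxy, hs⟩ := hℓ.exists_ne_lt (floorShift n) hε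
  set s := (floorShift n x)⁻¹ * floorShift n y with hs_def
  let d : ℕ → ℤ := fun m => ⌊(m : ℝ) * y⌋ - ⌊(m : ℝ) * x⌋
  have hd : {m | d m ≠ 0}.Infinite := by
    have := (finite_setOf_floor_mul_eq hxy).infinite_compl
    refine this.mono fun m hm h => ?_
    simp only [Set.mem_compl_iff, Set.mem_ofPred_eq] at hm
    simp only [d] at h
    omega
  have hs1 : ∀ m k, s (n, m, k) = (n, m, k + d m) := by
    intro m k
    simp only [hs_def, Equiv.Perm.mul_apply, floorShift_apply, floorShift_inv_apply, if_true, d]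
    congr 2
    ring
  have hs2 : ∀ p : ℕ × ℕ × ℤ, p.1 ≠ n → s p = p := by
    rintro ⟨j, m, k⟩ h
    simp only [hs_def, Equiv.Perm.mul_apply, floorShift_apply, floorShift_inv_apply, if_neg h]
    simp
  have hs3 : ∀ (i : ℕ) m k, (s ^ i) (n, m, k) = (n, m, k + i * d m) := by
    intro i
    induction i with
    | zero => intro m k; simp
    | succ i ih =>
      intro m k
      rw [pow_succ, Equiv.Perm.mul_apply, hs1, ih]
      push_cast
      congr 2
      ring
  let B : Set (ℕ × ℕ × ℤ) := {p | p.1 = n ∧ p.2.2 = 0 ∧ d p.2.1 ≠ 0}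
  refine ⟨B, ?_, ?_, fun τ hτ => ?_⟩
  · have := hd.image (f := fun m => ((n, m, 0) : ℕ × ℕ × ℤ))
      (fun a _ b _ h => by simpa using h)
    refine this.mono ?_
    rintro _ ⟨m, hm, rfl⟩
    exact ⟨rfl, rfl, hm⟩
  · refine (Set.infinite_range_of_injective
      (f := fun m : ℕ => ((n, m, 1) : ℕ × ℕ × ℤ)) fun a b h => by simpa using h).mono ?_
    rintro _ ⟨m, rfl⟩ h
    exact one_ne_zero h.2.1
  · obtain ⟨a, ha, ha'⟩ := exists_commutator_eq s τ B hτ (by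
      rintro i hi ⟨j, m, k⟩ ⟨rfl, rfl, hm⟩ h
      rw [hs3] at h
      have := h.2.1
      simp only [zero_add, mul_eq_zero, Nat.cast_eq_zero] at this
      exact this.elim hi.ne' hm)
    have ha1 : ∀ p : ℕ × ℕ × ℤ, p.1 ≠ n → a p = p := by
      intro p hp
      apply ha'
      rintro i ⟨j, m, k⟩ ⟨rfl, rfl, hm⟩ rfl
      rw [hs3] at hp
      exact hp rfl
    obtain ⟨w, hw, hwa⟩ := hn a ha1
    have hconj : w * s * w⁻¹ = a * s * a⁻¹ := by
      have hv : ∀ p : ℕ × ℕ × ℤ, p.1 = n → (a⁻¹ * w) p = p := by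
        intro p hp
        rw [Equiv.Perm.mul_apply, hwa p hp, perm_inv_apply_apply]
      have hv' : ∀ p : ℕ × ℕ × ℤ, p.1 ≠ n → ((a⁻¹ * w) p).1 ≠ n := by
        intro p hp h
        have := (a⁻¹ * w).injective (hv _ h)
        rw [this] at h
        exact hp h
      have hcomm : s * (a⁻¹ * w) = (a⁻¹ * w) * s := by
        ext1 p
        rw [Equiv.Perm.mul_apply, Equiv.Perm.mul_apply _ s]
        by_cases hp : p.1 = n
        · rw [hv p hp]
          have : (s p).1 = n := by
            obtain ⟨j, m, k⟩ := p
            obtain rfl : j = n := hp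
            rw [hs1]
          rw [hv _ this]
        · rw [hs2 p hp, hs2 _ (hv' p hp)]
      calc w * s * w⁻¹ = a * ((a⁻¹ * w) * s) * w⁻¹ := by group
        _ = a * (s * (a⁻¹ * w)) * w⁻¹ := by rw [hcomm]
        _ = a * s * a⁻¹ := by group
    rw [← ha, ← hconj]
    have h1 := hℓ.mul (w * s * w⁻¹) s⁻¹
    have h2 := hℓ.mul (w * s) w⁻¹
    have h3 := hℓ.mul w s
    rw [hℓ.inv] at h1 h2
    linarith

end IsSeparableLength

theorem exists_subset_infinite_sdiff_infinite {Ω : Type*} {R : Set Ω} (hR : R.Infinite) :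
    ∃ K ⊆ R, K.Infinite ∧ (R \ K).Infinite := by
  obtain ⟨t, u, htu, hd, hcard⟩ := hR.exists_union_disjoint_cardinal_eq_of_infinite
  have hiff : t.Infinite ↔ u.Infinite := by
    rw [← Set.infinite_coe_iff, ← Set.infinite_coe_iff, Cardinal.infinite_iff,
      Cardinal.infinite_iff, hcard]
  have ht : t.Infinite := by
    rw [← htu, Set.infinite_union] at hR
    exact hR.elim id hiff.2
  refine ⟨t, htu ▸ Set.subset_union_left, ht, (hiff.1 ht).mono fun p hp => ?_⟩
  exact ⟨htu ▸ Or.inr hp, fun h => hd.le_bot ⟨h, hp⟩⟩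

/-- The graph of `m ↦ ⌊m x⌋`; these form an almost disjoint family. -/
def floorGraph (x : ℝ) : Set (ℕ × ℕ × ℤ) := {p | p.1 = 0 ∧ p.2.2 = ⌊(p.2.1 : ℝ) * x⌋}

theorem floorGraph_infinite (x : ℝ) : (floorGraph x).Infinite := by
  refine (Set.infinite_range_of_injective
    (f := fun m : ℕ => ((0, m, ⌊(m : ℝ) * x⌋) : ℕ × ℕ × ℤ)) fun a b h => by
      have := congrArg (fun p : ℕ × ℕ × ℤ => p.2.1) h
      exact this).mono ?_
  rintro _ ⟨m, rfl⟩
  exact ⟨rfl, rfl⟩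

theorem floorGraph_union_compl_infinite (x y : ℝ) :
    (floorGraph x ∪ floorGraph y)ᶜ.Infinite := by
  refine (Set.infinite_range_of_injective
    (f := fun m : ℕ => ((1, m, 0) : ℕ × ℕ × ℤ)) fun a b h => by simpa using h).mono ?_
  rintro _ ⟨m, rfl⟩ (h | h)
  · exact one_ne_zero h.1
  · exact one_ne_zero h.1

theorem floorGraph_inter_finite {x y : ℝ} (hxy : x ≠ y) :
    (floorGraph x ∩ floorGraph y).Finite := by
  refine ((finite_setOf_floor_mul_eq hxy).image
    (fun m => ((0, m, ⌊(m : ℝ) * x⌋) : ℕ × ℕ × ℤ))).subset ?_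
  rintro ⟨j, m, k⟩ ⟨⟨h1, h2⟩, -, h3⟩
  simp only at h1 h2 h3
  exact ⟨m, h2.symm.trans h3, by simp [h1, h2]⟩

namespace IsSeparableLength

theorem exists_finite_small {ℓ : Equiv.Perm (ℕ × ℕ × ℤ) → ℝ} (hℓ : IsSeparableLength ℓ)
    {ε : ℝ} (hε : 0 < ε) :
    ∃ F : Set (ℕ × ℕ × ℤ), F.Finite ∧
      ∀ τ : Equiv.Perm (ℕ × ℕ × ℤ), (∀ p ∈ F, τ p = p) → ℓ τ < 48 * ε := by
  obtain ⟨B, hB, hC, hsmall⟩ := hℓ.exists_small_support hε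
  have hg : ∀ x : ℝ, ∃ g : Equiv.Perm (ℕ × ℕ × ℤ), ∀ p, g p ∈ floorGraph x ↔ p ∈ Bᶜ := by
    intro x
    obtain ⟨g, hg, -⟩ := exists_perm_mem_iff Set.univ Bᶜ (floorGraph x) (Set.subset_univ _)
      (Set.subset_univ _) hC (floorGraph_infinite x) (by simpa [← Set.compl_eq_univ_sdiff] using hB)
      (by
        rw [← Set.compl_eq_univ_sdiff]
        simpa using floorGraph_union_compl_infinite x x)
    exact ⟨g, hg⟩
  choose g hg using hg
  obtain ⟨x, y, hxy, hlt⟩ := hℓ.exists_ne_lt g hε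
  set h := (g x)⁻¹ * g y with hh
  have hgh : ∀ p, g x (h p) = g y p := by
    intro p
    rw [hh, Equiv.Perm.mul_apply, perm_apply_inv_apply]
  have hmem : ∀ p, h p ∈ B ↔ g y p ∉ floorGraph x := by
    intro p
    rw [← hgh, hg, Set.mem_compl_iff, not_not]
  have hmem' : ∀ p, p ∈ B ↔ g y p ∉ floorGraph y := by
    intro p
    rw [hg, Set.mem_compl_iff, not_not]
  let B' : Set (ℕ × ℕ × ℤ) := {p | h p ∈ B}
  have hsmallB : ∀ τ : Equiv.Perm (ℕ × ℕ × ℤ), (∀ p ∉ B, τ p = p) → ℓ τ < 12 * ε :=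
    fun τ hτ => (hsmall τ hτ).trans (by linarith)
  have hsmallB' : ∀ τ : Equiv.Perm (ℕ × ℕ × ℤ), (∀ p ∉ B', τ p = p) → ℓ τ < 12 * ε := by
    intro τ hτ
    have h1 := hsmall (h * τ * h⁻¹) (by
      intro p hp
      rw [Equiv.Perm.mul_apply, Equiv.Perm.mul_apply, hτ, perm_apply_inv_apply]
      simpa only [B', Set.mem_ofPred_eq, perm_apply_inv_apply] using hp)
    have h2 := hℓ.conj_le h τ
    linarith
  let F : Set (ℕ × ℕ × ℤ) := {p | p ∉ B ∧ p ∉ B'}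
  have hF : F.Finite := by
    refine ((floorGraph_inter_finite hxy).preimage (g y).injective.injOn).subset ?_
    rintro p ⟨h1, h2⟩
    rw [hmem', not_not] at h1
    simp only [B', Set.mem_ofPred_eq] at h2
    rw [hmem, not_not] at h2
    exact ⟨h2, h1⟩
  have hR : (B ∩ B').Infinite := by
    have := (floorGraph_union_compl_infinite x y).preimage (f := g y)
      (by rw [(g y).surjective.range_eq]; exact Set.subset_univ _)
    refine this.mono fun p hp => ?_
    simp only [Set.mem_preimage, Set.mem_compl_iff, Set.mem_union, not_or] at hp
    exact ⟨(hmem' p).2 hp.2, (hmem p).2 hp.1⟩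
  have hQ : (B' \ B).Infinite := by
    refine (hC.sdiff hF).mono fun p hp => ⟨?_, hp.1⟩
    by_contra h'
    exact hp.2 ⟨hp.1, h'⟩
  refine ⟨F, hF, fun σ hσ => ?_⟩
  have hσ' : ∀ p, p ∉ F → σ p ∉ F := by
    intro p hp h'
    have := σ.injective (hσ _ h')
    rw [this] at h'
    exact hp h'
  have step : ∀ M : Set (ℕ × ℕ × ℤ), B ∩ B' ⊆ M → (B ∩ B' ∩ σ ⁻¹' M).Infinite →
      ∃ K ⊆ B ∩ B', K.Infinite ∧ ((B ∩ B') \ K).Infinite ∧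
        ∃ v : Equiv.Perm (ℕ × ℕ × ℤ), Set.EqOn v σ K ∧ ∀ p ∉ M, v p = p := by
    intro M hM hinf
    obtain ⟨K, hK, hKinf, hKd⟩ := exists_subset_infinite_sdiff_infinite hinf
    have hKd' : ((B ∩ B') \ K).Infinite := hKd.mono fun p hp => ⟨hp.1.1, hp.2⟩
    refine ⟨K, fun p hp => (hK hp).1, hKinf, hKd', ?_⟩
    refine exists_perm_eqOn_of_subset M K σ σ.injective.injOn (fun p hp => hM (hK hp).1)
      (fun p hp => (hK hp).2) (hKd'.mono fun p hp => ⟨hM hp.1, hp.2⟩) ?_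
    refine (hKd.image σ.injective.injOn).mono ?_
    rintro _ ⟨p, hp, rfl⟩
    refine ⟨hp.1.2, ?_⟩
    rintro ⟨q, hq, hqp⟩
    exact hp.2 (σ.injective hqp ▸ hq)
  have hcases : ∃ K ⊆ B ∩ B', K.Infinite ∧ ((B ∩ B') \ K).Infinite ∧
      ∃ v : Equiv.Perm (ℕ × ℕ × ℤ), Set.EqOn v σ K ∧ (∀ p ∈ F, v p = p) ∧ ℓ v < 12 * ε := by
    have hsplit : B ∩ B' = (B ∩ B' ∩ σ ⁻¹' B) ∪ (B ∩ B' ∩ σ ⁻¹' B') := by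
      ext p
      constructor
      · intro hp
        by_cases h1 : σ p ∈ B
        · exact Or.inl ⟨hp, h1⟩
        · refine Or.inr ⟨hp, ?_⟩
          by_contra h2
          exact hσ' p (fun h' => h'.1 hp.1) ⟨h1, h2⟩
      · rintro (hp | hp) <;> exact hp.1
    have hR' := hR
    rw [hsplit, Set.infinite_union] at hR'
    rcases hR' with h' | h'
    · obtain ⟨K, h1, h2, h3, v, h4, h5⟩ := step B Set.inter_subset_left h'
      exact ⟨K, h1, h2, h3, v, h4, fun p hp => h5 p hp.1, hsmallB v h5⟩
    · obtain ⟨K, h1, h2, h3, v, h4, h5⟩ := step B' Set.inter_subset_right h'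
      exact ⟨K, h1, h2, h3, v, h4, fun p hp => h5 p hp.2, hsmallB' v h5⟩
  obtain ⟨K, hKR, hK, hRK, v, hv, hvF, hvℓ⟩ := hcases
  obtain ⟨w, hw, hw'⟩ := exists_perm_mem_iff B' K (B' \ B) (fun p hp => (hKR hp).2)
    Set.sdiff_subset hK hQ (hRK.mono fun p hp => ⟨hp.1.2, hp.2⟩)
    (hR.mono fun p hp => ⟨hp.2, fun h' => h'.2 hp.1⟩)
  have h1 := hsmallB (w * (v⁻¹ * σ) * w⁻¹) (by
    intro p hp
    suffices hfix : (v⁻¹ * σ) (w⁻¹ p) = w⁻¹ p by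
      rw [Equiv.Perm.mul_apply, Equiv.Perm.mul_apply, hfix, perm_apply_inv_apply]
    rw [Equiv.Perm.mul_apply]
    by_cases hpB' : p ∈ B'
    · have : w⁻¹ p ∈ K := by
        rw [← hw, perm_apply_inv_apply]
        exact ⟨hpB', hp⟩
      rw [← hv this, perm_inv_apply_apply]
    · have hwp : w⁻¹ p = p := by
        rw [Equiv.Perm.inv_eq_iff_eq, hw' p hpB']
      rw [hwp, hσ p ⟨hp, hpB'⟩, Equiv.Perm.inv_eq_iff_eq, hvF p ⟨hp, hpB'⟩])
  have h2 := hℓ.conj_le w (v⁻¹ * σ)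
  have h3 := hsmallB' w hw'
  have h4 := hℓ.mul v (v⁻¹ * σ)
  rw [mul_inv_cancel_left] at h4
  linarith

/-- Separable length functions on the full symmetric group are continuous at the identity. -/
theorem exists_finset_lt {ℓ : Equiv.Perm ℕ → ℝ} (hℓ : IsSeparableLength ℓ) {ε : ℝ} (hε : 0 < ε) :
    ∃ F : Finset ℕ, ∀ τ : Equiv.Perm ℕ, (∀ i ∈ F, τ i = i) → ℓ τ < ε := by
  obtain ⟨e⟩ := nonempty_equiv_of_countable (α := ℕ × ℕ × ℤ) (β := ℕ)
  let φ := Equiv.permCongrHom e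
  have hφ : IsSeparableLength (fun σ => ℓ (φ σ)) :=
    { inv := fun g => by rw [map_inv, hℓ.inv]
      mul := fun g h => by rw [map_mul]; exact hℓ.mul _ _
      exists_seq := fun δ hδ => by
        obtain ⟨u, hu⟩ := hℓ.exists_seq δ hδ
        refine ⟨fun n => φ.symm (u n), fun g => ?_⟩
        obtain ⟨n, hn⟩ := hu (φ g)
        exact ⟨n, by simpa using hn⟩ }
  obtain ⟨F, hF, h⟩ := hφ.exists_finite_small (show 0 < ε / 48 by positivity)
  refine ⟨(hF.image e).toFinset, fun τ hτ => ?_⟩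
  have h1 := h (φ.symm τ) (by
    intro p hp
    have := hτ (e p) (by simp [hp])
    change e.symm (τ (e.symm.symm p)) = p
    rw [Equiv.symm_symm, this, Equiv.symm_apply_apply])
  simp only [MulEquiv.apply_symm_apply] at h1
  linarith

end IsSeparableLength

section Unitary

variable {H : Type*} [NormedAddCommGroup H] [InnerProductSpace ℝ H]

theorem unitary_map_mul_apply {G : Type*} [Group G] (U : G →* (H ≃ₗᵢ[ℝ] H)) (g h : G) (v : H) :
    U (g * h) v = U g (U h v) := by
  rw [map_mul]
  rfl

section Group

variable {G : Type*} [Group G] (U : G →* (H ≃ₗᵢ[ℝ] H)) (Γ : Subgroup G)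

/-- The vector `v` is fixed by the subgroup `Γ`. -/
def IsFixedBy (v : H) : Prop := ∀ g ∈ Γ, U g v = v

/-- The closed convex hull of the orbit of `v` under `Γ`. -/
def orbitHull (v : H) : Set H := closure (convexHull ℝ ((fun g => U g v) '' (Γ : Set G)))

variable {U Γ}

theorem map_mem_orbitHull {v x : H} {g : G} (hg : g ∈ Γ) (hx : x ∈ orbitHull U Γ v) :
    U g x ∈ orbitHull U Γ v := by
  refine map_mem_closure (U g).continuous hx fun y hy => ?_
  suffices h : convexHull ℝ ((fun g => U g v) '' (Γ : Set G)) ⊆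
      (U g).toLinearEquiv.toLinearMap ⁻¹' convexHull ℝ ((fun g => U g v) '' (Γ : Set G)) from h hy
  refine convexHull_min ?_ ((convex_convexHull _ _).linear_preimage _)
  rintro _ ⟨k, hk, rfl⟩
  refine subset_convexHull _ _ ⟨g * k, Γ.mul_mem hg hk, ?_⟩
  simp [map_mul]

theorem orbitHull_subset {v : H} {S : Set H} (hS : Convex ℝ S) (hc : IsClosed S)
    (h : ∀ g ∈ Γ, U g v ∈ S) : orbitHull U Γ v ⊆ S := by
  refine closure_minimal (convexHull_min ?_ hS) hc
  rintro _ ⟨g, hg, rfl⟩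
  exact h g hg

variable (U Γ) in
theorem exists_isFixedBy_mem_orbitHull [CompleteSpace H] (v : H) :
    ∃ u ∈ orbitHull U Γ v, IsFixedBy U Γ u := by
  have hconv : Convex ℝ (orbitHull U Γ v) := (convex_convexHull _ _).closure
  have hne : (orbitHull U Γ v).Nonempty :=
    ⟨U 1 v, subset_closure (subset_convexHull _ _ ⟨1, Γ.one_mem, rfl⟩)⟩
  obtain ⟨u, hu, hmin⟩ := exists_norm_eq_iInf_of_complete_convex hne
    isClosed_closure.isComplete hconv 0
  rw [norm_eq_iInf_iff_real_inner_le_zero hconv hu] at hmin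
  refine ⟨u, hu, fun g hg => ?_⟩
  have h1 := hmin _ (map_mem_orbitHull hg hu)
  rw [zero_sub, inner_neg_left, inner_sub_right, real_inner_self_eq_norm_sq] at h1
  have h2 := norm_sub_sq_real (U g u) u
  rw [LinearIsometryEquiv.norm_map, real_inner_comm] at h2
  have h3 : ‖U g u - u‖ ^ 2 ≤ 0 := by linarith
  have h4 : ‖U g u - u‖ = 0 := by
    have := sq_nonneg ‖U g u - u‖
    exact pow_eq_zero_iff (two_ne_zero) |>.1 (le_antisymm h3 this)
  exact sub_eq_zero.1 (norm_eq_zero.1 h4)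

theorem inner_eq_of_mem_orbitHull {u v z : H} (hu : u ∈ orbitHull U Γ v)
    (hz : IsFixedBy U Γ z) : inner ℝ z u = inner ℝ z v := by
  refine orbitHull_subset (S := {x | inner ℝ z x = inner ℝ z v}) ?_ ?_ ?_ hu
  · intro x hx y hy a b _ _ hab
    simp only [Set.mem_ofPred_eq] at hx hy ⊢
    rw [inner_add_right, inner_smul_right, inner_smul_right, hx, hy, ← add_mul, hab, one_mul]
  · exact isClosed_eq (continuous_const.inner continuous_id) continuous_const
  · intro g hg
    have := (U g).inner_map_map z v
    rwa [hz g hg] at this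

theorem IsFixedBy.map_conj {v : H} {Γ' : Subgroup G} (hv : IsFixedBy U Γ v) (g : G)
    (h : ∀ k ∈ Γ', g⁻¹ * k * g ∈ Γ) : IsFixedBy U Γ' (U g v) := by
  intro k hk
  have h1 : U k (U g v) = U g (U (g⁻¹ * k * g) v) := by
    rw [← unitary_map_mul_apply, ← unitary_map_mul_apply]
    congr 2
    group
  rw [h1, hv _ (h k hk)]

theorem isSeparableLength_norm_sub [SecondCountableTopology H] (v : H) :
    IsSeparableLength fun g => ‖U g v - v‖ where
  inv g := by
    rw [← LinearIsometryEquiv.norm_map (U g), map_sub, ← unitary_map_mul_apply,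
      mul_inv_cancel, map_one, LinearIsometryEquiv.coe_one, id, norm_sub_rev]
  mul g h := by
    rw [unitary_map_mul_apply]
    calc ‖U g (U h v) - v‖ ≤ ‖U g (U h v) - U g v‖ + ‖U g v - v‖ :=
          norm_sub_le_norm_sub_add_norm_sub _ _ _
      _ = ‖U g v - v‖ + ‖U h v - v‖ := by
        rw [← map_sub, LinearIsometryEquiv.norm_map, add_comm]
  exists_seq ε hε := by
    have : Nonempty (Set.range fun g => U g v) := ⟨⟨U 1 v, 1, rfl⟩⟩
    obtain ⟨d, hd⟩ := TopologicalSpace.exists_dense_seq (Set.range fun g => U g v)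
    choose u hu using fun n => (d n).2
    refine ⟨u, fun g => ?_⟩
    obtain ⟨n, hn⟩ := hd.exists_dist_lt ⟨U g v, g, rfl⟩ hε
    refine ⟨n, ?_⟩
    rw [Subtype.dist_eq, ← hu n, dist_eq_norm] at hn
    rwa [← LinearIsometryEquiv.norm_map (U (u n)), map_sub, ← unitary_map_mul_apply, mul_inv_cancel_left]

variable (U Γ) in
/-- The orthogonal projection of `v` onto the fixed vectors of `Γ`. -/
noncomputable def fixedPart [CompleteSpace H] (v : H) : H :=
  (exists_isFixedBy_mem_orbitHull U Γ v).choose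

variable [CompleteSpace H]

theorem fixedPart_mem_orbitHull (v : H) : fixedPart U Γ v ∈ orbitHull U Γ v :=
  (exists_isFixedBy_mem_orbitHull U Γ v).choose_spec.1

theorem isFixedBy_fixedPart (v : H) : IsFixedBy U Γ (fixedPart U Γ v) :=
  (exists_isFixedBy_mem_orbitHull U Γ v).choose_spec.2

theorem inner_fixedPart {z : H} (hz : IsFixedBy U Γ z) (v : H) :
    inner ℝ z (fixedPart U Γ v) = inner ℝ z v :=
  inner_eq_of_mem_orbitHull (fixedPart_mem_orbitHull v) hz

theorem inner_fixedPart_right (v w : H) :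
    inner ℝ v (fixedPart U Γ w) = inner ℝ (fixedPart U Γ v) w := by
  rw [real_inner_comm, ← inner_fixedPart (isFixedBy_fixedPart w) v, real_inner_comm,
    inner_fixedPart (isFixedBy_fixedPart v) w]

theorem norm_fixedPart_sub_le {v : H} {ε : ℝ} (h : ∀ g ∈ Γ, ‖U g v - v‖ ≤ ε) :
    ‖fixedPart U Γ v - v‖ ≤ ε := by
  have := orbitHull_subset (convex_closedBall v ε) Metric.isClosed_closedBall
    (fun g hg => mem_closedBall_iff_norm.2 (h g hg)) (fixedPart_mem_orbitHull v)
  exact mem_closedBall_iff_norm.1 this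

end Group

/-- The permutations fixing every element of `F`. -/
abbrev pointStabilizer (F : Finset ℕ) : Subgroup (Equiv.Perm ℕ) :=
  fixingSubgroup (Equiv.Perm ℕ) (F : Set ℕ)

theorem mem_pointStabilizer {F : Finset ℕ} {g : Equiv.Perm ℕ} :
    g ∈ pointStabilizer F ↔ ∀ i ∈ F, g i = i := by
  simp [pointStabilizer, mem_fixingSubgroup_iff]

theorem pointStabilizer_anti {A B : Finset ℕ} (h : A ⊆ B) :
    pointStabilizer B ≤ pointStabilizer A := fun _ hg =>
  mem_pointStabilizer.2 fun i hi => mem_pointStabilizer.1 hg i (h hi)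

/-- Any finite set of points outside `C` can be moved off a finite set `A` fixing `C`. -/
theorem exists_mem_pointStabilizer_forall_notMem (A C E : Finset ℕ) :
    ∃ h ∈ pointStabilizer C, ∀ i ∈ E, i ∉ C → h i ∉ A := by
  classical
  obtain ⟨N, hN⟩ := (A ∪ C ∪ E).exists_nat_subset_range
  obtain ⟨σ, hσ⟩ := exists_perm_eqOn_finite ((C ∪ E : Finset ℕ) : Set ℕ)
    (fun i => if i ∈ C then i else i + N) (by
      intro i hi j hj h
      have hi' : i < N := Finset.mem_range.1 (hN (by simp at hi ⊢; tauto))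
      have hj' : j < N := Finset.mem_range.1 (hN (by simp at hj ⊢; tauto))
      simp only at h
      split_ifs at h <;> omega) (Finset.finite_toSet _)
  refine ⟨σ, mem_pointStabilizer.2 fun i hi => ?_, fun i hi hiC hA => ?_⟩
  · rw [hσ (by simp [hi])]
    simp [hi]
  · rw [hσ (by simp [hi])] at hA
    simp only [hiC, if_false] at hA
    have := Finset.mem_range.1 (hN (by simp [hA] : i + N ∈ A ∪ C ∪ E))
    omega

variable [CompleteSpace H] {U : Equiv.Perm ℕ →* (H ≃ₗᵢ[ℝ] H)}

theorem exists_norm_fixedPart_sub_le [SecondCountableTopology H] (v : H) {ε : ℝ} (hε : 0 < ε) :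
    ∃ F : Finset ℕ, ‖fixedPart U (pointStabilizer F) v - v‖ ≤ ε := by
  obtain ⟨F, hF⟩ := (isSeparableLength_norm_sub (U := U) v).exists_finset_lt hε
  exact ⟨F, norm_fixedPart_sub_le fun g hg => (hF g (mem_pointStabilizer.1 hg)).le⟩

/-- The projections onto the fixed vectors of the stabilizers of `A` and `B` multiply to the one
for `A ∩ B`. -/
theorem inner_fixedPart_inter {A B : Finset ℕ} {v w : H} (hv : IsFixedBy U (pointStabilizer A) v)
    (hw : IsFixedBy U (pointStabilizer B) w) :
    inner ℝ v (fixedPart U (pointStabilizer (A ∩ B)) w) = inner ℝ v w := by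
  classical
  set C := A ∩ B with hC
  let S : Set H := {x | ∃ E : Finset ℕ, ∀ h ∈ pointStabilizer C,
    (∀ i ∈ E, i ∉ C → h i ∉ A) → inner ℝ v (U h x) = inner ℝ v w}
  have hS : Convex ℝ S := by
    rintro x ⟨E, hE⟩ y ⟨E', hE'⟩ a b _ _ hab
    refine ⟨E ∪ E', fun h hh hA => ?_⟩
    rw [map_add, map_smul, map_smul, inner_add_right, inner_smul_right, inner_smul_right,
      hE h hh (fun i hi => hA i (Finset.mem_union_left _ hi)),
      hE' h hh (fun i hi => hA i (Finset.mem_union_right _ hi)), ← add_mul, hab, one_mul]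
  have horb : ∀ g ∈ pointStabilizer C, U g w ∈ S := by
    intro g hg
    refine ⟨B.image g, fun h hh hA => ?_⟩
    have hk := mem_pointStabilizer.1 ((pointStabilizer C).mul_mem hh hg)
    have hkA : ∀ i ∈ B, i ∉ C → (h * g) i ∉ A := fun i hi hiC => by
      refine hA (g i) (Finset.mem_image_of_mem _ hi) fun hgi => hiC ?_
      have := mem_pointStabilizer.1 hg _ hgi
      rwa [g.injective this] at hgi
    rw [← unitary_map_mul_apply]
    set k := h * g
    have hkA' : ∀ i ∈ B, k i ∈ A → k i = i := fun i hi hiA =>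
      hk i (by_contra fun hiC => hkA i hi hiC hiA)
    obtain ⟨σ, hσ⟩ := exists_perm_eqOn_finite ((A ∪ B : Finset ℕ) : Set ℕ)
      (fun i => if i ∈ A then i else k i) (by
        intro i hi j hj h
        simp only [Finset.coe_union, Set.mem_union, SetLike.mem_coe] at hi hj
        simp only at h
        split_ifs at h with h1 h2 h2
        · exact h
        · have h3 := hj.resolve_left h2
          rw [h] at h1 ⊢
          exact hkA' j h3 h1
        · have h3 := hi.resolve_left h1
          rw [← h] at h2 ⊢
          exact (hkA' i h3 h2).symm
        · exact k.injective h) (Finset.finite_toSet _)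
    have hσA : σ ∈ pointStabilizer A := mem_pointStabilizer.2 fun i hi => by
      rw [hσ (by simp [hi])]
      simp [hi]
    have hσB : ∀ i ∈ B, σ i = k i := fun i hi => by
      rw [hσ (by simp [hi])]
      simp only [ite_eq_right_iff]
      intro hiA
      exact (hk i (Finset.mem_inter.2 ⟨hiA, hi⟩)).symm
    have h1 : U k w = U σ w := by
      have h2 : σ⁻¹ * k ∈ pointStabilizer B := mem_pointStabilizer.2 fun i hi => by
        rw [Equiv.Perm.mul_apply, ← hσB i hi, perm_inv_apply_apply]
      have h3 := hw _ h2
      calc U k w = U (σ * (σ⁻¹ * k)) w := by rw [mul_inv_cancel_left]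
        _ = U σ w := by rw [unitary_map_mul_apply, h3]
    rw [h1]
    conv_lhs => rw [← hv σ hσA]
    rw [LinearIsometryEquiv.inner_map_map]
  set u := fixedPart U (pointStabilizer C) w with hu
  have hmem : u ∈ closure S := by
    refine closure_mono (convexHull_min ?_ hS) (fixedPart_mem_orbitHull w)
    rintro _ ⟨g, hg, rfl⟩
    exact horb g hg
  rw [← sub_eq_zero, ← norm_eq_zero]
  refine le_antisymm (le_of_forall_pos_le_add fun ε hε => ?_) (norm_nonneg _)
  obtain ⟨x, ⟨E, hE⟩, hx⟩ := Metric.mem_closure_iff.1 hmem (ε / (‖v‖ + 1)) (by positivity)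
  obtain ⟨h, hh, hhA⟩ := exists_mem_pointStabilizer_forall_notMem A C E
  have huh : U h u = u := isFixedBy_fixedPart w h hh
  rw [← hE h hh hhA, ← huh, ← inner_sub_right, ← map_sub, zero_add]
  refine (norm_inner_le_norm _ _).trans ?_
  rw [LinearIsometryEquiv.norm_map, ← dist_eq_norm]
  rw [lt_div_iff₀ (by positivity)] at hx
  nlinarith [norm_nonneg v, dist_nonneg (x := u) (y := x)]

end Unitary

section Koopman

variable {X G : Type*} [MeasurableSpace X]

/-- The Radon-Nikodym cocycle of a quasi-invariant action. -/
noncomputable def actionDensity (μ : Measure X) (T : G → X ≃ᵐ X) (g : G) : X → ENNReal :=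
  (μ.map (T g).symm).rnDeriv μ

/-- The square root of the Radon-Nikodym cocycle. -/
noncomputable def actionWeight (μ : Measure X) (T : G → X ≃ᵐ X) (g : G) (x : X) : ℝ :=
  √(actionDensity μ T g x).toReal

theorem measurable_actionDensity (μ : Measure X) (T : G → X ≃ᵐ X) (g : G) :
    Measurable (actionDensity μ T g) := Measure.measurable_rnDeriv _ _

theorem measurable_actionWeight (μ : Measure X) (T : G → X ≃ᵐ X) (g : G) :
    Measurable (actionWeight μ T g) := (measurable_actionDensity μ T g).ennreal_toReal.sqrt

theorem actionWeight_sq (μ : Measure X) [IsFiniteMeasure μ] (T : G → X ≃ᵐ X) (g : G) :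
    ∀ᵐ x ∂μ, ENNReal.ofReal (actionWeight μ T g x ^ 2) = actionDensity μ T g x := by
  filter_upwards [Measure.rnDeriv_lt_top (μ.map (T g).symm) μ] with x hx
  rw [actionWeight, Real.sq_sqrt ENNReal.toReal_nonneg]
  exact ENNReal.ofReal_toReal hx.ne

variable [Group G]

/-- A measurable right action of `G` for which `μ` is quasi-invariant. -/
structure IsQuasiInvariantAction (μ : Measure X) (T : G → X ≃ᵐ X) : Prop where
  map_one : T 1 = MeasurableEquiv.refl X
  map_mul : ∀ g h : G, T (g * h) = (T g).trans (T h)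
  map_ac : ∀ g : G, μ.map (T g) ≪ μ

namespace IsQuasiInvariantAction

variable {μ : Measure X} {T : G → X ≃ᵐ X}

theorem mul_apply (hT : IsQuasiInvariantAction μ T)
    (g h : G) (x : X) : T (g * h) x = T h (T g x) := by
  rw [hT.map_mul]
  rfl

theorem one_apply (hT : IsQuasiInvariantAction μ T) (x : X) : T 1 x = x := by
  rw [hT.map_one]
  rfl

theorem inv_apply_apply (hT : IsQuasiInvariantAction μ T) (g : G) (x : X) : T g⁻¹ (T g x) = x := by
  rw [← hT.mul_apply, mul_inv_cancel, hT.one_apply]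

theorem apply_inv_apply (hT : IsQuasiInvariantAction μ T) (g : G) (x : X) : T g (T g⁻¹ x) = x := by
  rw [← hT.mul_apply, inv_mul_cancel, hT.one_apply]

theorem symm_eq (hT : IsQuasiInvariantAction μ T) (g : G) : (T g).symm = T g⁻¹ := by
  ext x
  rw [MeasurableEquiv.symm_apply_eq, hT.apply_inv_apply]

theorem quasiMeasurePreserving (hT : IsQuasiInvariantAction μ T)
    (g : G) : Measure.QuasiMeasurePreserving (T g) μ μ :=
  ⟨(T g).measurable, hT.map_ac g⟩

theorem ae_apply (hT : IsQuasiInvariantAction μ T)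
    {p : X → Prop} (h : ∀ᵐ x ∂μ, p x) (g : G) : ∀ᵐ x ∂μ, p (T g x) :=
  (hT.quasiMeasurePreserving g).ae h

theorem map_symm_ac (hT : IsQuasiInvariantAction μ T)
    (g : G) : μ.map (T g).symm ≪ μ := hT.symm_eq g ▸ hT.map_ac g⁻¹

theorem ac_map_symm (hT : IsQuasiInvariantAction μ T) (g : G) : μ ≪ μ.map (T g).symm := by
  have := (hT.map_ac g).map (T g).symm.measurable
  rwa [Measure.map_map (T g).symm.measurable (T g).measurable, MeasurableEquiv.symm_comp_self,
    Measure.map_id] at this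

theorem lintegral_actionDensity_mul [IsFiniteMeasure μ] (hT : IsQuasiInvariantAction μ T)
    (g : G) {F : X → ENNReal}
    (hF : AEMeasurable F μ) :
    ∫⁻ x, actionDensity μ T g x * F (T g x) ∂μ = ∫⁻ x, F x ∂μ := by
  have h := lintegral_rnDeriv_mul (hT.map_symm_ac g)
    (hF.comp_quasiMeasurePreserving (hT.quasiMeasurePreserving g))
  refine h.trans ?_
  rw [lintegral_map_equiv]
  simp

theorem actionDensity_pos [IsFiniteMeasure μ] (hT : IsQuasiInvariantAction μ T)
    (g : G) : ∀ᵐ x ∂μ, 0 < actionDensity μ T g x :=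
  Measure.rnDeriv_pos' (hT.ac_map_symm g)

theorem actionDensity_mul [IsFiniteMeasure μ] (hT : IsQuasiInvariantAction μ T) (g h : G) :
    ∀ᵐ x ∂μ, actionDensity μ T (g * h) x = actionDensity μ T g x * actionDensity μ T h (T g x) := by
  have hmap : μ.map (T (g * h)).symm = (μ.map (T h).symm).map (T g).symm := by
    rw [Measure.map_map (T g).symm.measurable (T h).symm.measurable, hT.map_mul]
    rfl
  have h1 := Measure.rnDeriv_mul_rnDeriv (κ := μ)
    ((hT.map_symm_ac h).map (T g).symm.measurable)
  have h2 := (T g).symm.measurableEmbedding.rnDeriv_map (μ.map (T h).symm) μ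
  have h3 := hT.ae_apply h2 g
  rw [← hmap] at h1 h3
  filter_upwards [h1, h3] with x hx1 hx3
  rw [MeasurableEquiv.symm_apply_apply] at hx3
  rw [actionDensity, ← hx1, Pi.mul_apply, hx3, mul_comm]
  rfl

theorem actionWeight_pos [IsFiniteMeasure μ] (hT : IsQuasiInvariantAction μ T)
    (g : G) : ∀ᵐ x ∂μ, 0 < actionWeight μ T g x := by
  filter_upwards [actionWeight_sq μ T g, hT.actionDensity_pos g] with x h1 h2
  rw [← h1, ENNReal.ofReal_pos] at h2
  refine lt_of_le_of_ne (Real.sqrt_nonneg _) fun h => ?_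
  rw [← h] at h2
  norm_num at h2

theorem actionWeight_mul [IsFiniteMeasure μ] (hT : IsQuasiInvariantAction μ T) (g h : G) :
    ∀ᵐ x ∂μ, actionWeight μ T (g * h) x = actionWeight μ T g x * actionWeight μ T h (T g x) := by
  filter_upwards [hT.actionDensity_mul g h] with x hx
  rw [actionWeight, hx, ENNReal.toReal_mul, Real.sqrt_mul ENNReal.toReal_nonneg]
  rfl

theorem actionWeight_one [IsFiniteMeasure μ] (hT : IsQuasiInvariantAction μ T)
    : ∀ᵐ x ∂μ, actionWeight μ T 1 x = 1 := by
  filter_upwards [Measure.rnDeriv_self μ] with x hx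
  have : μ.map (T 1).symm = μ := by
    rw [hT.map_one]
    exact Measure.map_id
  rw [actionWeight, actionDensity, this, hx]
  simp

theorem eLpNorm_koopman [IsFiniteMeasure μ] (hT : IsQuasiInvariantAction μ T)
    (g : G) {f : X → ℝ} (hf : AEStronglyMeasurable f μ) :
    eLpNorm (fun x => actionWeight μ T g x * f (T g x)) 2 μ = eLpNorm f 2 μ := by
  rw [eLpNorm_eq_lintegral_rpow_enorm_toReal two_ne_zero ENNReal.ofNat_ne_top,
    eLpNorm_eq_lintegral_rpow_enorm_toReal two_ne_zero ENNReal.ofNat_ne_top]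
  congr 1
  rw [← hT.lintegral_actionDensity_mul g (F := fun x => ‖f x‖ₑ ^ (2 : ENNReal).toReal)
    (hf.enorm.pow_const _)]
  refine lintegral_congr_ae ?_
  filter_upwards [actionWeight_sq μ T g] with x hx
  have h0 : 0 ≤ actionWeight μ T g x := Real.sqrt_nonneg _
  rw [enorm_mul, ENNReal.mul_rpow_of_nonneg _ _ ENNReal.toReal_nonneg, ← hx,
    Real.enorm_of_nonneg h0]
  congr 1
  rw [ENNReal.ofReal_pow h0, ENNReal.toReal_ofNat]
  exact_mod_cast rfl

theorem memLp_koopman [IsFiniteMeasure μ] (hT : IsQuasiInvariantAction μ T)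
    (g : G) {f : X → ℝ} (hf : MemLp f 2 μ) :
    MemLp (fun x => actionWeight μ T g x * f (T g x)) 2 μ := by
  refine ⟨(measurable_actionWeight μ T g).aestronglyMeasurable.mul
    (hf.1.comp_quasiMeasurePreserving (hT.quasiMeasurePreserving g)), ?_⟩
  rw [hT.eLpNorm_koopman g hf.1]
  exact hf.2

/-- The unitary Koopman operator, as a linear isometry. -/
noncomputable def koopmanIsometry [IsFiniteMeasure μ] (hT : IsQuasiInvariantAction μ T) (g : G) :
    Lp ℝ 2 μ →ₗᵢ[ℝ] Lp ℝ 2 μ where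
  toFun f := (hT.memLp_koopman g (Lp.memLp f)).toLp _
  map_add' f₁ f₂ := by
    rw [← MemLp.toLp_add, MemLp.toLp_eq_toLp_iff]
    filter_upwards [hT.ae_apply (Lp.coeFn_add f₁ f₂) g] with x hx
    simp only [hx, Pi.add_apply, mul_add]
  map_smul' c f := by
    rw [RingHom.id_apply, ← MemLp.toLp_const_smul, MemLp.toLp_eq_toLp_iff]
    filter_upwards [hT.ae_apply (Lp.coeFn_smul c f) g] with x hx
    simp only [hx, Pi.smul_apply, smul_eq_mul]
    ring
  norm_map' f := by
    change ‖(hT.memLp_koopman g (Lp.memLp f)).toLp _‖ = ‖f‖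
    rw [Lp.norm_toLp, hT.eLpNorm_koopman g (Lp.aestronglyMeasurable f)]
    rfl

theorem coeFn_koopmanIsometry [IsFiniteMeasure μ] (hT : IsQuasiInvariantAction μ T)
    (g : G) (f : Lp ℝ 2 μ) :
    ∀ᵐ x ∂μ, hT.koopmanIsometry g f x = actionWeight μ T g x * f (T g x) :=
  MemLp.coeFn_toLp (hT.memLp_koopman g (Lp.memLp f))

theorem koopmanIsometry_mul [IsFiniteMeasure μ] (hT : IsQuasiInvariantAction μ T)
    (g h : G) (f : Lp ℝ 2 μ) :
    hT.koopmanIsometry (g * h) f = hT.koopmanIsometry g (hT.koopmanIsometry h f) := by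
  refine Lp.ext ?_
  filter_upwards [hT.coeFn_koopmanIsometry (g * h) f,
    hT.coeFn_koopmanIsometry g (hT.koopmanIsometry h f),
    hT.ae_apply (hT.coeFn_koopmanIsometry h f) g, hT.actionWeight_mul g h] with x h1 h2 h3 h4
  rw [h1, h2, h3, h4, hT.mul_apply, mul_assoc]

theorem koopmanIsometry_one [IsFiniteMeasure μ] (hT : IsQuasiInvariantAction μ T) (f : Lp ℝ 2 μ) :
    hT.koopmanIsometry 1 f = f := by
  refine Lp.ext ?_
  filter_upwards [hT.coeFn_koopmanIsometry 1 f, hT.actionWeight_one] with x h1 h2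
  rw [h1, h2, hT.one_apply, one_mul]

/-- The unitary Koopman representation on `L²`. -/
noncomputable def koopman [IsFiniteMeasure μ] (hT : IsQuasiInvariantAction μ T)
    : G →* (Lp ℝ 2 μ ≃ₗᵢ[ℝ] Lp ℝ 2 μ) where
  toFun g :=
    { hT.koopmanIsometry g with
      invFun := hT.koopmanIsometry g⁻¹
      left_inv := fun f => by
        change hT.koopmanIsometry g⁻¹ (hT.koopmanIsometry g f) = f
        rw [← hT.koopmanIsometry_mul, inv_mul_cancel, hT.koopmanIsometry_one]
      right_inv := fun f => by
        change hT.koopmanIsometry g (hT.koopmanIsometry g⁻¹ f) = f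
        rw [← hT.koopmanIsometry_mul, mul_inv_cancel, hT.koopmanIsometry_one] }
  map_one' := LinearIsometryEquiv.ext hT.koopmanIsometry_one
  map_mul' g h := LinearIsometryEquiv.ext (hT.koopmanIsometry_mul g h)

theorem coeFn_koopman [IsFiniteMeasure μ] (hT : IsQuasiInvariantAction μ T) (g : G) (f : Lp ℝ 2 μ) :
    ∀ᵐ x ∂μ, hT.koopman g f x = actionWeight μ T g x * f (T g x) :=
  hT.coeFn_koopmanIsometry g f

end IsQuasiInvariantAction

end Koopman

section MaskedVectors

variable {X : Type*} [MeasurableSpace X] {μ : Measure X}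

theorem memLp_indicator_abs (v : Lp ℝ 2 μ) {Z : Set X} (hZ : MeasurableSet Z) :
    MemLp (Z.indicator fun x => |v x|) 2 μ := (Lp.memLp v).abs.indicator hZ

/-- The absolute value of `v` restricted to `Z`, as a vector of `L²`. -/
noncomputable def absMask (v : Lp ℝ 2 μ) {Z : Set X} (hZ : MeasurableSet Z) : Lp ℝ 2 μ :=
  (memLp_indicator_abs v hZ).toLp _

theorem coeFn_absMask (v : Lp ℝ 2 μ) {Z : Set X} (hZ : MeasurableSet Z) :
    ∀ᵐ x ∂μ, absMask v hZ x = Z.indicator (fun x => |v x|) x :=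
  MemLp.coeFn_toLp (memLp_indicator_abs v hZ)

theorem measurableSet_ne_zero (v : Lp ℝ 2 μ) : MeasurableSet {x | v x ≠ 0} :=
  (Lp.stronglyMeasurable v).measurable (measurableSet_singleton (0 : ℝ)).compl

theorem inner_eq_zero_of_ae_mul_eq_zero {v w : Lp ℝ 2 μ} (h : ∀ᵐ x ∂μ, v x * w x = 0) :
    inner ℝ v w = 0 := by
  rw [L2.inner_def]
  refine integral_eq_zero_of_ae ?_
  filter_upwards [h] with x hx
  simpa [mul_comm] using hx

theorem ae_mul_eq_zero_of_inner_eq_zero {v w : Lp ℝ 2 μ} (h : inner ℝ v w = 0)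
    (h0 : ∀ᵐ x ∂μ, 0 ≤ v x * w x) : ∀ᵐ x ∂μ, v x * w x = 0 := by
  rw [L2.inner_def, integral_eq_zero_iff_of_nonneg_ae _ (L2.integrable_inner v w)] at h
  · filter_upwards [h] with x hx
    simpa [mul_comm] using hx
  · filter_upwards [h0] with x hx
    simpa [mul_comm] using hx

variable (μ) in
/-- The constant function `1` in `L²`. -/
noncomputable def oneLp [IsFiniteMeasure μ] : Lp ℝ 2 μ :=
  indicatorConstLp 2 MeasurableSet.univ (measure_ne_top μ _) 1

theorem coeFn_oneLp [IsFiniteMeasure μ] : ∀ᵐ x ∂μ, oneLp μ x = 1 := by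
  filter_upwards [indicatorConstLp_coeFn (p := 2) (hs := MeasurableSet.univ)
    (hμs := measure_ne_top μ _) (c := (1 : ℝ))] with x hx
  rw [oneLp, hx]
  simp

variable {G : Type*} [Group G] {T : G → X ≃ᵐ X} [IsFiniteMeasure μ] {Γ : Subgroup G}

theorem IsFixedBy.absMask {hT : IsQuasiInvariantAction μ T} {v : Lp ℝ 2 μ}
    (hv : IsFixedBy hT.koopman Γ v) {Z : Set X} (hZ : MeasurableSet Z)
    (hinv : ∀ g ∈ Γ, ∀ᵐ x ∂μ, T g x ∈ Z ↔ x ∈ Z) :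
    IsFixedBy hT.koopman Γ (absMask v hZ) := by
  intro g hg
  refine Lp.ext ?_
  have h := hT.coeFn_koopman g v
  rw [hv g hg] at h
  filter_upwards [h, hT.coeFn_koopman g (_root_.absMask v hZ), hT.ae_apply (coeFn_absMask v hZ) g,
    coeFn_absMask v hZ, hinv g hg] with x h1 h2 h3 h4 h5
  rw [h2, h3, h4]
  by_cases hx : x ∈ Z
  · rw [Set.indicator_of_mem hx, Set.indicator_of_mem (h5.2 hx), h1, abs_mul,
      abs_of_nonneg (a := actionWeight μ T g x) (Real.sqrt_nonneg _)]
  · rw [Set.indicator_of_notMem hx, Set.indicator_of_notMem (mt h5.1 hx), mul_zero]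

theorem IsFixedBy.ae_ne_zero_iff {hT : IsQuasiInvariantAction μ T} {v : Lp ℝ 2 μ}
    (hv : IsFixedBy hT.koopman Γ v) {g : G} (hg : g ∈ Γ) :
    ∀ᵐ x ∂μ, T g x ∈ {x | v x ≠ 0} ↔ x ∈ {x | v x ≠ 0} := by
  have h := hT.coeFn_koopman g v
  rw [hv g hg] at h
  filter_upwards [h, hT.actionWeight_pos g] with x h1 h2
  simp [h1, h2.ne']

end MaskedVectors

theorem map_eq_self_of_mem_pointStabilizer {g : Equiv.Perm ℕ} {A : Finset ℕ}
    (hg : g ∈ pointStabilizer A) : A.map g.toEmbedding = A := by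
  rw [mem_pointStabilizer] at hg
  ext i
  simp only [Finset.mem_map, Equiv.coe_toEmbedding]
  exact ⟨fun ⟨j, hj, h⟩ => by rwa [← h, hg j hj], fun hi => ⟨i, hi, hg i hi⟩⟩

namespace IsQuasiInvariantAction

section FixedSupport

variable {X : Type*} [MeasurableSpace X] {μ : Measure X} {T : Equiv.Perm ℕ → X ≃ᵐ X}
  [IsFiniteMeasure μ] (hT : IsQuasiInvariantAction μ T)

/-- The projection of the constant `1` to the vectors fixed by the stabilizer of `F`. -/
noncomputable def fixedOne (F : Finset ℕ) : Lp ℝ 2 μ :=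
  fixedPart hT.koopman (pointStabilizer F) (oneLp μ)

theorem isFixedBy_fixedOne (F : Finset ℕ) :
    IsFixedBy hT.koopman (pointStabilizer F) (hT.fixedOne F) := isFixedBy_fixedPart _

/-- The largest set carrying vectors fixed by the stabilizer of `F`. -/
def fixedSupport (F : Finset ℕ) : Set X := {x | hT.fixedOne F x ≠ 0}

theorem measurableSet_fixedSupport (F : Finset ℕ) : MeasurableSet (hT.fixedSupport F) :=
  measurableSet_ne_zero _

theorem ae_eq_zero_of_isFixedBy {A : Finset ℕ} {v : Lp ℝ 2 μ}
    (hv : IsFixedBy hT.koopman (pointStabilizer A) v) :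
    ∀ᵐ x ∂μ, x ∉ hT.fixedSupport A → v x = 0 := by
  have hZ := (hT.measurableSet_fixedSupport A).compl
  have hw := hv.absMask hZ fun g hg => by
    filter_upwards [(hT.isFixedBy_fixedOne A).ae_ne_zero_iff hg] with x hx
    exact not_congr hx
  have h1 : inner ℝ (absMask v hZ) (oneLp μ) = 0 := by
    rw [← inner_fixedPart hw]
    refine inner_eq_zero_of_ae_mul_eq_zero ?_
    filter_upwards [coeFn_absMask v hZ] with x hx
    rw [hx]
    by_cases h : x ∈ hT.fixedSupport A
    · rw [Set.indicator_of_notMem (by simpa using h), zero_mul]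
    · have : hT.fixedOne A x = 0 := not_not.1 h
      rw [fixedOne] at this
      rw [this, mul_zero]
  filter_upwards [ae_mul_eq_zero_of_inner_eq_zero h1 (by
    filter_upwards [coeFn_absMask v hZ, coeFn_oneLp (μ := μ)] with x h1 h2
    rw [h1, h2, mul_one]
    exact Set.indicator_nonneg (fun _ _ => abs_nonneg _) _), coeFn_absMask v hZ,
    coeFn_oneLp (μ := μ)] with x h2 h3 h4 hx
  rwa [h4, mul_one, h3, Set.indicator_of_mem (by exact hx), abs_eq_zero] at h2

theorem ae_mem_fixedSupport_of_apply_mem (g : Equiv.Perm ℕ) (A : Finset ℕ) :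
    ∀ᵐ x ∂μ, T g x ∈ hT.fixedSupport A → x ∈ hT.fixedSupport (A.map g.toEmbedding) := by
  have h1 : IsFixedBy hT.koopman (pointStabilizer (A.map g.toEmbedding))
      (hT.koopman g (hT.fixedOne A)) := by
    refine (hT.isFixedBy_fixedOne A).map_conj g fun k hk => ?_
    rw [mem_pointStabilizer] at hk ⊢
    intro i hi
    have := hk (g i) (Finset.mem_map_of_mem _ hi)
    rw [Equiv.Perm.mul_apply, Equiv.Perm.mul_apply, this, perm_inv_apply_apply]
  filter_upwards [hT.ae_eq_zero_of_isFixedBy h1, hT.coeFn_koopman g (hT.fixedOne A),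
    hT.actionWeight_pos g] with x h2 h3 h4 hx
  by_contra hn
  exact hx ((mul_eq_zero.1 (h3.symm.trans (h2 hn))).resolve_left h4.ne')

theorem ae_apply_mem_fixedSupport_iff (g : Equiv.Perm ℕ) (A : Finset ℕ) :
    ∀ᵐ x ∂μ, T g x ∈ hT.fixedSupport A ↔ x ∈ hT.fixedSupport (A.map g.toEmbedding) := by
  have hA : (A.map g.toEmbedding).map (g⁻¹).toEmbedding = A := by
    ext i
    simp only [Finset.mem_map, Equiv.coe_toEmbedding, exists_exists_and_eq_and,
      perm_inv_apply_apply, exists_eq_right]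
  filter_upwards [hT.ae_mem_fixedSupport_of_apply_mem g A,
    hT.ae_apply (hT.ae_mem_fixedSupport_of_apply_mem g⁻¹ (A.map g.toEmbedding)) g] with x h1 h2
  rw [hT.inv_apply_apply, hA] at h2
  exact ⟨h1, h2⟩

theorem ae_mem_fixedSupport_inter (A B : Finset ℕ) :
    ∀ᵐ x ∂μ, x ∈ hT.fixedSupport A → x ∈ hT.fixedSupport B → x ∈ hT.fixedSupport (A ∩ B) := by
  have hZ := (hT.measurableSet_fixedSupport (A ∩ B)).compl
  have hv := (hT.isFixedBy_fixedOne A).absMask MeasurableSet.univ fun g _ => by simp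
  have hw := (hT.isFixedBy_fixedOne B).absMask hZ fun g hg => by
    have := hT.ae_apply_mem_fixedSupport_iff g (A ∩ B)
    rw [map_eq_self_of_mem_pointStabilizer
      (pointStabilizer_anti Finset.inter_subset_right hg)] at this
    filter_upwards [this] with x hx
    exact not_congr hx
  have h1 := inner_fixedPart_inter hv hw
  rw [inner_fixedPart_right, inner_eq_zero_of_ae_mul_eq_zero] at h1
  · filter_upwards [ae_mul_eq_zero_of_inner_eq_zero h1.symm (by
      filter_upwards [coeFn_absMask (hT.fixedOne A) MeasurableSet.univ,
        coeFn_absMask (hT.fixedOne B) hZ] with x h1 h2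
      rw [h1, h2]
      exact mul_nonneg (Set.indicator_nonneg (fun _ _ => abs_nonneg _) _)
        (Set.indicator_nonneg (fun _ _ => abs_nonneg _) _)),
      coeFn_absMask (hT.fixedOne A) MeasurableSet.univ,
      coeFn_absMask (hT.fixedOne B) hZ] with x h2 h3 h4 hA hB
    by_contra hn
    rw [h3, h4, Set.indicator_of_mem (Set.mem_univ x), Set.indicator_of_mem (by exact hn),
      mul_eq_zero, abs_eq_zero, abs_eq_zero] at h2
    exact h2.elim hA hB
  · filter_upwards [hT.ae_eq_zero_of_isFixedBy (isFixedBy_fixedPart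
      (U := hT.koopman) (Γ := pointStabilizer (A ∩ B))
      (absMask (hT.fixedOne A) MeasurableSet.univ)),
      coeFn_absMask (hT.fixedOne B) hZ] with x h2 h3
    rw [h3]
    by_cases h : x ∈ hT.fixedSupport (A ∩ B)
    · rw [Set.indicator_of_notMem (by simpa using h), mul_zero]
    · rw [h2 h, zero_mul]

theorem ae_exists_mem_fixedSupport [MeasurableSpace.CountablyGenerated X] :
    ∀ᵐ x ∂μ, ∃ F, x ∈ hT.fixedSupport F := by
  have hm : MeasurableSet (⋃ F, hT.fixedSupport F)ᶜ :=
    (MeasurableSet.iUnion hT.measurableSet_fixedSupport).compl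
  set Z := (⋃ F, hT.fixedSupport F)ᶜ with hZ
  have hfin : μ Z ≠ ⊤ := measure_ne_top μ Z
  set v : Lp ℝ 2 μ := indicatorConstLp 2 hm hfin 1
  have h0 : ∀ F, inner ℝ v (hT.fixedOne F) = 0 := by
    intro F
    rw [L2.inner_indicatorConstLp_one]
    refine setIntegral_eq_zero_of_forall_eq_zero fun x hx => ?_
    by_contra h
    exact hx (Set.mem_iUnion.2 ⟨F, h⟩)
  have h1 : inner ℝ v (oneLp μ) = μ.real Z := by
    rw [L2.inner_indicatorConstLp_one, setIntegral_congr_ae (g := fun _ => (1 : ℝ)) hm]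
    · simp
    · filter_upwards [coeFn_oneLp (μ := μ)] with x hx _ using hx
  have h2 : ∀ ε : ℝ, 0 < ε → μ.real Z ≤ ‖v‖ * ε := by
    intro ε hε
    have : Fact ((2 : ENNReal) ≠ ⊤) := ⟨ENNReal.ofNat_ne_top⟩
    obtain ⟨F, hF⟩ := exists_norm_fixedPart_sub_le (U := hT.koopman) (oneLp μ) hε
    have h3 := abs_real_inner_le_norm v (hT.fixedOne F - oneLp μ)
    rw [inner_sub_right, h0, h1, zero_sub, abs_neg, abs_of_nonneg measureReal_nonneg] at h3
    exact h3.trans (mul_le_mul_of_nonneg_left hF (norm_nonneg _))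
  have h3 : μ.real Z ≤ 0 := by
    refine le_of_forall_pos_le_add fun ε hε => ?_
    refine (h2 (ε / (‖v‖ + 1)) (by positivity)).trans ?_
    rw [zero_add, mul_div_assoc', div_le_iff₀ (by positivity)]
    nlinarith [norm_nonneg v]
  have h4 : μ Z = 0 := by
    have := le_antisymm h3 measureReal_nonneg
    rwa [measureReal_def, ENNReal.toReal_eq_zero_iff, or_iff_left hfin] at this
  filter_upwards [measure_eq_zero_iff_ae_notMem.1 h4] with x hx
  simpa [hZ] using hx

/-- The measure with density the square of `fixedOne`. -/
noncomputable def stableMeasure (F : Finset ℕ) : Measure X :=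
  μ.withDensity fun x => ENNReal.ofReal (hT.fixedOne F x ^ 2)

theorem measurable_fixedOne_sq (F : Finset ℕ) :
    Measurable fun x => ENNReal.ofReal (hT.fixedOne F x ^ 2) :=
  ((Lp.stronglyMeasurable (hT.fixedOne F)).measurable.pow_const 2).ennreal_ofReal

theorem stableMeasure_ac (F : Finset ℕ) : hT.stableMeasure F ≪ μ :=
  withDensity_absolutelyContinuous _ _

theorem isFiniteMeasure_stableMeasure (F : Finset ℕ) :
    IsFiniteMeasure (hT.stableMeasure F) :=
  isFiniteMeasure_withDensity_ofReal (Lp.memLp (hT.fixedOne F)).integrable_sq.2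

theorem measure_inter_fixedSupport_eq_zero {F : Finset ℕ} {N : Set X}
    (h : hT.stableMeasure F N = 0) : μ (N ∩ hT.fixedSupport F) = 0 := by
  rw [stableMeasure, withDensity_apply_eq_zero (hT.measurable_fixedOne_sq F)] at h
  refine measure_mono_null ?_ h
  rintro x ⟨hx, hF⟩
  refine ⟨?_, hx⟩
  simpa using (show hT.fixedOne F x ≠ 0 from hF)

theorem map_stableMeasure {F : Finset ℕ} {g : Equiv.Perm ℕ} (hg : g ∈ pointStabilizer F) :
    (hT.stableMeasure F).map (T g) = hT.stableMeasure F := by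
  have h := hT.coeFn_koopman g (hT.fixedOne F)
  rw [hT.isFixedBy_fixedOne F g hg] at h
  ext A hA
  rw [Measure.map_apply (T g).measurable hA, stableMeasure,
    withDensity_apply _ ((T g).measurable hA), withDensity_apply _ hA,
    ← lintegral_indicator hA, ← lintegral_indicator ((T g).measurable hA),
    ← hT.lintegral_actionDensity_mul g (((hT.measurable_fixedOne_sq F).indicator hA).aemeasurable)]
  refine lintegral_congr_ae ?_
  filter_upwards [h, actionWeight_sq μ T g] with x h1 h2
  by_cases hx : T g x ∈ A
  · rw [Set.indicator_of_mem hx, Set.indicator_of_mem (by exact hx), ← h2, h1, mul_pow,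
      ENNReal.ofReal_mul (sq_nonneg _)]
  · rw [Set.indicator_of_notMem hx, Set.indicator_of_notMem (by exact hx), mul_zero]

end FixedSupport

end IsQuasiInvariantAction

theorem exists_perm_map_range_eq (B : Finset ℕ) :
    ∃ g : Equiv.Perm ℕ, (Finset.range B.card).map g.toEmbedding = B := by
  have hB : {i | i ∈ B}.Finite := B.finite_toSet
  have hcard : hB.toFinset.card = B.card := by
    congr 1
    ext i
    simp
  have hinj := Nat.nth_injOn hB
  have himg := Nat.image_nth_Iio_card hB
  rw [hcard] at hinj himg
  obtain ⟨g, hg⟩ := exists_perm_eqOn_finite _ _ hinj (Set.finite_Iio _)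
  refine ⟨g, Finset.coe_injective ?_⟩
  rw [Finset.coe_map, Finset.coe_range, Equiv.coe_toEmbedding, hg.image_eq, himg]
  rfl

/-- Cosets of the stabilizers of the initial segments of `ℕ`. -/
abbrev InitialCoset : Type := Σ k : ℕ, Equiv.Perm ℕ ⧸ pointStabilizer (Finset.range k)

namespace InitialCoset

/-- The graph of the injection of an initial segment into `ℕ` given by a coset. -/
noncomputable def graph (i : InitialCoset) : Finset (ℕ × ℕ) :=
  (Finset.range i.1).image fun j => (j, i.2.out j)

theorem mem_graph {i : InitialCoset} {p : ℕ × ℕ} :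
    p ∈ i.graph ↔ p.1 < i.1 ∧ i.2.out p.1 = p.2 := by
  simp only [graph, Finset.mem_image, Finset.mem_range]
  constructor
  · rintro ⟨j, hj, rfl⟩
    exact ⟨hj, rfl⟩
  · rintro ⟨hj, h⟩
    exact ⟨p.1, hj, Prod.ext rfl h⟩

theorem graph_injective : Function.Injective graph := by
  rintro ⟨k, q⟩ ⟨k', q'⟩ h
  have hk : ∀ i : InitialCoset, i.graph.card = i.1 := fun i => by
    rw [graph, Finset.card_image_of_injective _ fun a b hab => congrArg Prod.fst hab,
      Finset.card_range]
  obtain rfl : k = k' :=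
    (hk ⟨k, q⟩).symm.trans ((congrArg Finset.card h).trans (hk ⟨k', q'⟩))
  congr 1
  rw [← q.out_eq, ← q'.out_eq]
  refine QuotientGroup.eq.2 (mem_pointStabilizer.2 fun j hj => ?_)
  have h1 : (j, q.out j) ∈ graph ⟨k, q'⟩ := h ▸ mem_graph.2 ⟨Finset.mem_range.1 hj, rfl⟩
  rw [Equiv.Perm.mul_apply, (mem_graph.1 h1).2, perm_inv_apply_apply]

instance : Countable InitialCoset := graph_injective.countable

theorem finite_setOf_map_eq (B : Finset ℕ) :
    {i : InitialCoset | (Finset.range i.1).map i.2.out.toEmbedding = B}.Finite := by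
  refine Set.Finite.of_injOn (f := graph)
    (t := ((Finset.range B.card ×ˢ B).powerset : Set (Finset (ℕ × ℕ)))) ?_
    graph_injective.injOn (Finset.finite_toSet _)
  rintro i rfl
  rw [Finset.mem_coe, Finset.mem_powerset]
  intro p hp
  obtain ⟨h1, h2⟩ := mem_graph.1 hp
  rw [Finset.mem_product, Finset.card_map, Finset.card_range, ← h2]
  exact ⟨Finset.mem_range.2 h1, Finset.mem_map_of_mem _ (Finset.mem_range.2 h1)⟩

/-- Left translation of cosets. -/
def translate (h : Equiv.Perm ℕ) : InitialCoset ≃ InitialCoset :=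
  Equiv.sigmaCongrRight fun _ => MulAction.toPerm h

end InitialCoset

namespace IsQuasiInvariantAction

section InvariantMeasure

variable {X : Type*} [MeasurableSpace X] {μ : Measure X} {T : Equiv.Perm ℕ → X ≃ᵐ X}
  [IsFiniteMeasure μ] (hT : IsQuasiInvariantAction μ T)

/-- The points of the fixed support of `F` not in the fixed support of a smaller set. -/
def stratum (F : Finset ℕ) : Set X :=
  hT.fixedSupport F \ ⋃ C : Finset ℕ, ⋃ _ : C.card < F.card, hT.fixedSupport C

theorem mem_stratum {F : Finset ℕ} {x : X} : x ∈ hT.stratum F ↔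
    x ∈ hT.fixedSupport F ∧ ∀ C : Finset ℕ, C.card < F.card → x ∉ hT.fixedSupport C := by
  simp [stratum]

theorem measurableSet_stratum (F : Finset ℕ) : MeasurableSet (hT.stratum F) :=
  (hT.measurableSet_fixedSupport F).diff <| MeasurableSet.iUnion fun C =>
    MeasurableSet.iUnion fun _ => hT.measurableSet_fixedSupport C

theorem ae_apply_mem_stratum_iff (g : Equiv.Perm ℕ) (A : Finset ℕ) :
    ∀ᵐ x ∂μ, T g x ∈ hT.stratum A ↔ x ∈ hT.stratum (A.map g.toEmbedding) := by
  filter_upwards [ae_all_iff.2 (hT.ae_apply_mem_fixedSupport_iff g)] with x hx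
  rw [mem_stratum, mem_stratum, hx, Finset.card_map]
  refine and_congr_right fun _ => ⟨fun h C hC => ?_, fun h C hC => ?_⟩
  · have hmap : (C.map (g⁻¹).toEmbedding).map g.toEmbedding = C := by
      ext i
      simp only [Finset.mem_map, Equiv.coe_toEmbedding, exists_exists_and_eq_and,
        perm_apply_inv_apply, exists_eq_right]
    have := h (C.map (g⁻¹).toEmbedding) (by rwa [Finset.card_map])
    rwa [hx, hmap] at this
  · rw [hx]
    exact h _ (by rwa [Finset.card_map])

theorem ae_stratum_unique :
    ∀ᵐ x ∂μ, ∀ A B, x ∈ hT.stratum A → x ∈ hT.stratum B → A = B := by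
  filter_upwards [ae_all_iff.2 fun A => ae_all_iff.2 (hT.ae_mem_fixedSupport_inter A)]
    with x hx A B hA hB
  rw [mem_stratum] at hA hB
  have h := hx A B hA.1 hB.1
  have h1 : A ∩ B = A := Finset.eq_of_subset_of_card_le Finset.inter_subset_left
    (not_lt.1 fun hlt => hA.2 _ hlt h)
  have h2 : A ∩ B = B := Finset.eq_of_subset_of_card_le Finset.inter_subset_right
    (not_lt.1 fun hlt => hB.2 _ hlt h)
  exact h1.symm.trans h2

theorem ae_exists_mem_stratum [MeasurableSpace.CountablyGenerated X] :
    ∀ᵐ x ∂μ, ∃ F, x ∈ hT.stratum F := by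
  filter_upwards [hT.ae_exists_mem_fixedSupport] with x hx
  obtain ⟨F, hF, hmin⟩ := exists_minimalFor_of_wellFoundedLT _ Finset.card hx
  refine ⟨F, hT.mem_stratum.2 ⟨hF, fun C hC hxC => ?_⟩⟩
  exact absurd (hmin hxC hC.le) (not_le.2 hC)

/-- The stable measure of an initial segment, restricted to its stratum. -/
noncomputable def baseMeasure (k : ℕ) : Measure X :=
  (hT.stableMeasure (Finset.range k)).restrict (hT.stratum (Finset.range k))

theorem baseMeasure_ac (k : ℕ) : hT.baseMeasure k ≪ μ :=
  Measure.absolutelyContinuous_of_le Measure.restrict_le_self |>.trans (hT.stableMeasure_ac _)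

theorem isFiniteMeasure_baseMeasure (k : ℕ) : IsFiniteMeasure (hT.baseMeasure k) := by
  have := hT.isFiniteMeasure_stableMeasure (Finset.range k)
  rw [baseMeasure]
  infer_instance

theorem ae_baseMeasure_mem_stratum (k : ℕ) :
    ∀ᵐ x ∂hT.baseMeasure k, x ∈ hT.stratum (Finset.range k) :=
  ae_restrict_mem (hT.measurableSet_stratum _)

theorem measure_inter_stratum_eq_zero {k : ℕ} {N : Set X} (hN : MeasurableSet N)
    (h : hT.baseMeasure k N = 0) : μ (N ∩ hT.stratum (Finset.range k)) = 0 := by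
  rw [baseMeasure, Measure.restrict_apply hN] at h
  refine measure_mono_null ?_ (hT.measure_inter_fixedSupport_eq_zero h)
  exact fun x hx => ⟨hx, (hT.mem_stratum.1 hx.2).1⟩

theorem map_baseMeasure {k : ℕ} {g : Equiv.Perm ℕ} (hg : g ∈ pointStabilizer (Finset.range k)) :
    (hT.baseMeasure k).map (T g) = hT.baseMeasure k := by
  have h := hT.ae_apply_mem_stratum_iff g (Finset.range k)
  rw [map_eq_self_of_mem_pointStabilizer hg] at h
  have h1 : T g ⁻¹' hT.stratum (Finset.range k) =ᵐ[hT.stableMeasure (Finset.range k)]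
      hT.stratum (Finset.range k) := by
    filter_upwards [(hT.stableMeasure_ac _).ae_le h] with x hx
    exact propext hx
  rw [baseMeasure, ← Measure.restrict_congr_set h1, ← MeasurableEquiv.restrict_map,
    hT.map_stableMeasure hg, Measure.restrict_congr_set h1]

/-- The translate of a base measure. -/
noncomputable def translatedMeasure (k : ℕ) (g : Equiv.Perm ℕ) : Measure X :=
  (hT.baseMeasure k).map (T g⁻¹)

theorem map_translatedMeasure (k : ℕ) (g h : Equiv.Perm ℕ) :
    (hT.translatedMeasure k g).map (T h⁻¹) = hT.translatedMeasure k (h * g) := by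
  rw [translatedMeasure, translatedMeasure, mul_inv_rev, hT.map_mul,
    Measure.map_map (T h⁻¹).measurable (T g⁻¹).measurable]
  rfl

theorem translatedMeasure_mul_of_mem (k : ℕ) (g : Equiv.Perm ℕ) {s : Equiv.Perm ℕ}
    (hs : s ∈ pointStabilizer (Finset.range k)) :
    hT.translatedMeasure k (g * s) = hT.translatedMeasure k g := by
  rw [← map_translatedMeasure, translatedMeasure, hT.map_baseMeasure (inv_mem hs)]
  rfl

theorem translatedMeasure_out_mk (k : ℕ) (g : Equiv.Perm ℕ) :
    hT.translatedMeasure k (g : Equiv.Perm ℕ ⧸ pointStabilizer (Finset.range k)).out =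
      hT.translatedMeasure k g := by
  obtain ⟨s, hs⟩ := QuotientGroup.mk_out_eq_mul (pointStabilizer (Finset.range k)) g
  rw [hs, hT.translatedMeasure_mul_of_mem k g s.2]

theorem translatedMeasure_ac (k : ℕ) (g : Equiv.Perm ℕ) : hT.translatedMeasure k g ≪ μ :=
  ((hT.baseMeasure_ac k).map (T g⁻¹).measurable).trans (hT.map_ac g⁻¹)

theorem isFiniteMeasure_translatedMeasure (k : ℕ) (g : Equiv.Perm ℕ) :
    IsFiniteMeasure (hT.translatedMeasure k g) := by
  have := hT.isFiniteMeasure_baseMeasure k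
  rw [translatedMeasure]
  infer_instance

theorem ae_translatedMeasure_mem_stratum (k : ℕ) (g : Equiv.Perm ℕ) :
    ∀ᵐ x ∂hT.translatedMeasure k g, x ∈ hT.stratum ((Finset.range k).map g.toEmbedding) := by
  refine (ae_map_iff (p := (· ∈ hT.stratum ((Finset.range k).map g.toEmbedding)))
    (T g⁻¹).measurable.aemeasurable (hT.measurableSet_stratum _)).2 ?_
  filter_upwards [hT.ae_baseMeasure_mem_stratum k, (hT.baseMeasure_ac k).ae_le
    (hT.ae_apply (hT.ae_apply_mem_stratum_iff g (Finset.range k)) g⁻¹)] with x h1 h2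
  rw [hT.apply_inv_apply] at h2
  exact h2.1 h1

theorem translatedMeasure_stratum_eq_zero {k : ℕ} {g : Equiv.Perm ℕ} {B : Finset ℕ}
    (h : (Finset.range k).map g.toEmbedding ≠ B) :
    hT.translatedMeasure k g (hT.stratum B) = 0 := by
  rw [measure_eq_zero_iff_ae_notMem]
  filter_upwards [hT.ae_translatedMeasure_mem_stratum k g,
    (hT.translatedMeasure_ac k g).ae_le hT.ae_stratum_unique] with x h1 h2 h3
  exact h (h2 _ _ h1 h3)

/-- The invariant measure: the sum of all distinct translates of the base measures. -/
noncomputable def invariantMeasure : Measure X :=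
  Measure.sum fun i : InitialCoset => hT.translatedMeasure i.1 i.2.out

theorem map_invariantMeasure (h : Equiv.Perm ℕ) :
    hT.invariantMeasure.map (T h⁻¹) = hT.invariantMeasure := by
  rw [invariantMeasure, Measure.map_sum (T h⁻¹).measurable.aemeasurable]
  conv_rhs => rw [← Measure.sum_comp_equiv (InitialCoset.translate h)]
  congr 1
  funext ⟨k, q⟩
  change (hT.translatedMeasure k q.out).map (T h⁻¹) = hT.translatedMeasure k (h • q).out
  rw [map_translatedMeasure, ← MulAction.Quotient.coe_smul_out, translatedMeasure_out_mk]
  rfl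

theorem invariantMeasure_ac : hT.invariantMeasure ≪ μ :=
  Measure.absolutelyContinuous_sum_left fun _ => hT.translatedMeasure_ac _ _

theorem sigmaFinite_invariantMeasure [MeasurableSpace.CountablyGenerated X] :
    SigmaFinite hT.invariantMeasure := by
  refine Measure.sigmaFinite_of_countable
    (S := insert (⋃ B, hT.stratum B)ᶜ (Set.range hT.stratum))
    ((Set.countable_range _).insert _) ?_ ?_
  · rintro _ (rfl | ⟨B, rfl⟩)
    · have h0 : μ (⋃ B, hT.stratum B)ᶜ = 0 := by
        rw [measure_eq_zero_iff_ae_notMem]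
        filter_upwards [hT.ae_exists_mem_stratum] with x hx
        simpa using hx
      rw [hT.invariantMeasure_ac h0]
      exact ENNReal.zero_lt_top
    · rw [invariantMeasure, Measure.sum_apply _ (hT.measurableSet_stratum B),
        tsum_eq_sum (s := (InitialCoset.finite_setOf_map_eq B).toFinset) fun i hi =>
          hT.translatedMeasure_stratum_eq_zero (by simpa using hi)]
      refine ENNReal.sum_lt_top.2 fun i _ => ?_
      have := hT.isFiniteMeasure_translatedMeasure i.1 i.2.out
      exact measure_lt_top _ _
  · rw [Set.sUnion_insert, Set.sUnion_range, Set.compl_union_self]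

theorem ac_invariantMeasure [MeasurableSpace.CountablyGenerated X] :
    μ ≪ hT.invariantMeasure := by
  refine Measure.AbsolutelyContinuous.mk fun N hN h => ?_
  rw [invariantMeasure, Measure.sum_apply_eq_zero] at h
  have h1 : ∀ B, ∀ᵐ x ∂μ, x ∈ N → x ∉ hT.stratum B := by
    intro B
    obtain ⟨g, hg⟩ := exists_perm_map_range_eq B
    have h2 := h ⟨B.card, (g : Equiv.Perm ℕ ⧸ pointStabilizer (Finset.range B.card))⟩
    rw [translatedMeasure_out_mk, translatedMeasure,
      Measure.map_apply (T g⁻¹).measurable hN] at h2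
    have h3 := hT.measure_inter_stratum_eq_zero ((T g⁻¹).measurable hN) h2
    rw [measure_eq_zero_iff_ae_notMem] at h3
    filter_upwards [hT.ae_apply h3 g, hT.ae_apply_mem_stratum_iff g (Finset.range B.card)]
      with x h4 h5 hx hB
    rw [hg] at h5
    refine h4 ⟨?_, h5.2 hB⟩
    rwa [Set.mem_preimage, hT.inv_apply_apply]
  rw [measure_eq_zero_iff_ae_notMem]
  filter_upwards [ae_all_iff.2 h1, hT.ae_exists_mem_stratum] with x h2 ⟨F, hF⟩ hx
  exact h2 F hx hF

end InvariantMeasure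

end IsQuasiInvariantAction

/-- main theorem: if the full symmetric group of `ℕ` (all bijections of
`ℕ`) acts measurably on a measure space `(X, 𝔐, μ)` with countably generated σ-algebra
and `μ` is quasi-invariant (each `μ∘g` is equivalent to `μ`), then there exists a
σ-finite invariant measure `ν` equivalent to `μ`. -/
theorem statement18
    {X : Type*} [MeasurableSpace X] [MeasurableSpace.CountablyGenerated X]
    (μ : Measure X) [SigmaFinite μ]
    (T : Equiv.Perm ℕ → X ≃ᵐ X)
    (hT1 : T 1 = MeasurableEquiv.refl X)
    (hTmul : ∀ g h : Equiv.Perm ℕ, T (g * h) = (T g).trans (T h))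
    (hquasi : ∀ g : Equiv.Perm ℕ, μ.map (T g) ≪ μ ∧ μ ≪ μ.map (T g)) :
    ∃ ν : Measure X, SigmaFinite ν ∧ ν ≪ μ ∧ μ ≪ ν ∧
      ∀ g : Equiv.Perm ℕ, ∀ A : Set X, MeasurableSet A → ν (T g '' A) = ν A := by
  have hT : IsQuasiInvariantAction μ.toFinite T :=
    ⟨hT1, hTmul, fun g => (((toFinite_absolutelyContinuous μ).map (T g).measurable).trans
      (hquasi g).1).trans (absolutelyContinuous_toFinite μ)⟩
  refine ⟨hT.invariantMeasure, hT.sigmaFinite_invariantMeasure,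
    hT.invariantMeasure_ac.trans (toFinite_absolutelyContinuous μ),
    (absolutelyContinuous_toFinite μ).trans hT.ac_invariantMeasure, fun g A hA => ?_⟩
  conv_rhs => rw [← hT.map_invariantMeasure g, Measure.map_apply (T g⁻¹).measurable hA]
  rw [MeasurableEquiv.image_eq_preimage_symm, hT.symm_eq]
end
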